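/- Let G = ⟨s₁,…,s_r⟩ be the free group of rank r and G ↷ᵀ (X,B,μ) a G-system. If α and β are generating partitions with H(α) + H(β) < ∞ and F ⊂ B is a T(G)-invariant sub-σ-algebra, then f(T,α|F) = f(T,β|F) and f_*(T,α|F) = f_*(T,β|F). -/

import Mathlib

open MeasureTheory Filter
open scoped ENNReal symmDiff

namespace Bowen

noncomputable section

/-- The free group of rank `r`. -/
abbrev FG (r : ℕ) := FreeGroup (Fin r)

/-- The generating set element corresponding to `(i, b)`: `sᵢ` if `b = true`,
`sᵢ⁻¹` if `b = false`. -/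
def gen {r : ℕ} (s : Fin r × Bool) : FG r :=
  cond s.2 (FreeGroup.of s.1) (FreeGroup.of s.1)⁻¹

/-- The symmetric generating set `S = {s₁^{±1},…,s_r^{±1}}`. -/
def Sset (r : ℕ) : Set (FG r) := Set.range (gen (r := r))

/-- The ball of radius `n` about the identity in the word metric of `(G,S)`. -/
def ball (r n : ℕ) : Set (FG r) := {g | FreeGroup.norm g ≤ n}

section Partitions

variable {X : Type*} [mX : MeasurableSpace X] {K L : Type*}

/-- Shannon entropy of the countable labeled partition `p` with respect to `μ`
(in `ℝ≥0∞`, so that `H(p) < ∞` is meaningful). -/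
def Hpart (μ : Measure X) (p : X → K) : ℝ≥0∞ :=
  ∑' k : K, ENNReal.ofReal (Real.negMulLog ((μ (p ⁻¹' {k})).toReal))

/-- The atom of the partition `p` containing `x`. -/
def atomOf (p : X → K) (x : X) : Set X := p ⁻¹' {p x}

/-- Conditional Shannon entropy of `p` given the sub-σ-algebra `m`:
`H(p|m) = ∫ -log( μ(A_x | m)(x) ) dμ(x)`. -/
def HpartC (μ : Measure X) (p : X → K) (m : MeasurableSpace X) : ℝ≥0∞ :=
  ∫⁻ x, ENNReal.ofReal
    (- Real.log ((μ[(atomOf p x).indicator (fun _ => (1:ℝ)) | m]) x)) ∂μ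

/-- Join of two labeled partitions. -/
def pjoin (p : X → K) (q : X → L) : X → K × L := fun x => (p x, q x)

/-- Pullback partition `T_g^{-1} p`. -/
def pull {r : ℕ} (T : FG r → X → X) (g : FG r) (p : X → K) : X → K :=
  fun x => p (T g x)

/-- The join `⋁_{q ∈ Q} T_q^{-1} p` over a set `Q ⊆ G`. -/
def powS {r : ℕ} (T : FG r → X → X) (p : X → K) (Q : Set (FG r)) : X → (Q → K) :=
  fun x q => p (T (q : FG r) x)

/-- The join `p^n = ⋁_{g ∈ B(e,n)} T_g^{-1} p`. -/
def pow {r : ℕ} (T : FG r → X → X) (p : X → K) (n : ℕ) : X → (ball r n → K) :=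
  powS T p (ball r n)

/-- The σ-algebra generated by the partition `p`. -/
def sAlg (p : X → K) : MeasurableSpace X := MeasurableSpace.comap p ⊤

/-- The smallest `G`-invariant σ-algebra containing the partition `p`. -/
def sAlgG {r : ℕ} (T : FG r → X → X) (p : X → K) : MeasurableSpace X :=
  ⨆ g : FG r, sAlg (pull T g p)

/-- The σ-algebra `⋁_{f ∈ Q} T_f^{-1} p` for a (possibly infinite) `Q ⊆ G`. -/
def sAlgSet {r : ℕ} (T : FG r → X → X) (p : X → K) (Q : Set (FG r)) :
    MeasurableSpace X :=
  ⨆ f ∈ Q, sAlg (pull T f p)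

/-- `F(T,α) = (1−2r)H(α) + ∑ᵢ H(α ∨ T_{sᵢ}^{-1}α)`. -/
def FF {r : ℕ} (T : FG r → X → X) (μ : Measure X) (p : X → K) : ℝ :=
  (1 - 2 * (r : ℝ)) * (Hpart μ p).toReal
    + ∑ i : Fin r, (Hpart μ (pjoin p (pull T (FreeGroup.of i) p))).toReal

/-- `f(T,α) = inf_{n>0} F(T,α^n)`, as an extended real. -/
def littleF {r : ℕ} (T : FG r → X → X) (μ : Measure X) (p : X → K) : EReal :=
  ⨅ n : ℕ, ((FF T μ (pow T p (n + 1)) : ℝ) : EReal)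

/-- Conditional version `F(T,α|𝓕) = (1−2r)H(α|𝓕) + ∑ᵢ H(α ∨ T_{sᵢ}^{-1}α|𝓕)`. -/
def FFc {r : ℕ} (T : FG r → X → X) (μ : Measure X) (m : MeasurableSpace X)
    (p : X → K) : ℝ :=
  (1 - 2 * (r : ℝ)) * (HpartC (mX := mX) μ p m).toReal
    + ∑ i : Fin r, (HpartC (mX := mX) μ (pjoin p (pull T (FreeGroup.of i) p)) m).toReal

/-- Conditional `f(T,α|𝓕) = inf_{n>0} F(T,α^n|𝓕)`. -/
def littleFc {r : ℕ} (T : FG r → X → X) (μ : Measure X) (m : MeasurableSpace X)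
    (p : X → K) : EReal :=
  ⨅ n : ℕ, ((FFc (mX := mX) T μ m (pow T p (n + 1)) : ℝ) : EReal)

/-- The mean entropy `h(T_s, α) = lim_n H(⋁_{i=0}^n T_s^{-i}α)/(n+1)`; since the
sequence is subadditive the limit equals the infimum, which we take as the
definition. -/
def hrate {r : ℕ} (T : FG r → X → X) (μ : Measure X) (s : FG r) (p : X → K) : ℝ :=
  ⨅ n : ℕ, (Hpart μ (fun x (i : Fin (n + 1)) => p (T (s ^ (i : ℕ)) x))).toReal / (n + 1)

/-- Conditional mean entropy `h(T_s, α|𝓕) = lim_n H(⋁_{i=0}^n T_s^{-i}α | 𝓕)/(n+1)`;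
for an invariant `𝓕` the sequence is subadditive so the limit equals the infimum. -/
def hrateC {r : ℕ} (T : FG r → X → X) (μ : Measure X) (m : MeasurableSpace X)
    (s : FG r) (p : X → K) : ℝ :=
  ⨅ n : ℕ, (HpartC (mX := mX) μ (fun x (i : Fin (n + 1)) => p (T (s ^ (i : ℕ)) x)) m).toReal / (n + 1)

/-- `F_*(T,α) = (1−r)H(α) + ∑ᵢ h(T_{sᵢ},α)`. -/
def Fstar {r : ℕ} (T : FG r → X → X) (μ : Measure X) (p : X → K) : ℝ :=
  (1 - (r : ℝ)) * (Hpart μ p).toReal + ∑ i : Fin r, hrate T μ (FreeGroup.of i) p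

/-- `f_*(T,α) = inf_{n>0} F_*(T,α^n)`. -/
def fstar {r : ℕ} (T : FG r → X → X) (μ : Measure X) (p : X → K) : EReal :=
  ⨅ n : ℕ, ((Fstar T μ (pow T p (n + 1)) : ℝ) : EReal)

/-- `F_*(T,α|𝓕) = (1−r)H(α|𝓕) + ∑ᵢ h(T_{sᵢ},α|𝓕)`. -/
def FstarC {r : ℕ} (T : FG r → X → X) (μ : Measure X) (m : MeasurableSpace X)
    (p : X → K) : ℝ :=
  (1 - (r : ℝ)) * (HpartC (mX := mX) μ p m).toReal + ∑ i : Fin r, hrateC (mX := mX) T μ m (FreeGroup.of i) p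

/-- `f_*(T,α|𝓕) = inf_{n>0} F_*(T,α^n|𝓕)`. -/
def fstarC {r : ℕ} (T : FG r → X → X) (μ : Measure X) (m : MeasurableSpace X)
    (p : X → K) : EReal :=
  ⨅ n : ℕ, ((FstarC (mX := mX) T μ m (pow T p (n + 1)) : ℝ) : EReal)

/-- `p` refines `q`: each atom of `p` is contained, up to a `μ`-null set,
in an atom of `q`. -/
def Refines (μ : Measure X) (p : X → K) (q : X → L) : Prop :=
  ∀ k : K, ∃ l : L, μ (p ⁻¹' {k} \ q ⁻¹' {l}) = 0

/-- Two labeled partitions are equal as partitions (up to null sets). -/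
def PartEquiv (μ : Measure X) (p : X → K) (q : X → L) : Prop :=
  Refines μ p q ∧ Refines μ q p

/-- `σ` is a simple splitting of `p`: `σ = p ∨ T_s^{-1}β` for some `s ∈ S` and
some coarsening `β` of `p`. -/
def SimpleSplit {r : ℕ} (μ : Measure X) (T : FG r → X → X) (p σ : X → ℕ) : Prop :=
  ∃ s ∈ Sset r, ∃ β : X → ℕ, Measurable β ∧ Refines μ p β ∧
    PartEquiv μ σ (pjoin p (pull T s β))

/-- `τ` is a splitting of `p`: obtained from `p` by a finite sequence of simple
splittings (as a partition, i.e. up to relabeling and null sets). -/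
def IsSplitting {r : ℕ} (μ : Measure X) (T : FG r → X → X) (p : X → ℕ)
    (τ : X → K) : Prop :=
  ∃ σ : X → ℕ, Relation.ReflTransGen (SimpleSplit μ T) p σ ∧ PartEquiv μ σ τ

/-- A partition is generating if the smallest `G`-invariant σ-algebra containing it
is the full σ-algebra up to `μ`-null sets. -/
def Generating {r : ℕ} (T : FG r → X → X) (μ : Measure X) (p : X → K) : Prop :=
  ∀ A : Set X, MeasurableSet A →
    ∃ A' : Set X, MeasurableSet[sAlgG T p] A' ∧ μ (A ∆ A') = 0

/-- The Rohlin distance `d(α,β) = H(α|β) + H(β|α)`. -/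
def rohlinDist (μ : Measure X) (p : X → K) (q : X → L) : ℝ :=
  (HpartC μ p (sAlg q)).toReal + (HpartC μ q (sAlg p)).toReal

end Partitions

/-- Adjacency in the left Cayley graph `Γ_L`: an edge joins `a` and `sa`, `s ∈ S`. -/
def adjL {r : ℕ} (a b : FG r) : Prop := ∃ s ∈ Sset r, b = s * a

/-- `Past(g₁;g₂)`: the set of `f ∈ G` such that every path in the left Cayley
graph from `f` to `g₁` passes through `g₂`. -/
def Past {r : ℕ} (g₁ g₂ : FG r) : Set (FG r) :=
  {f | ∀ l : List (FG r), l ≠ [] → l.head? = some f → l.getLast? = some g₁ →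
        l.Chain' adjL → g₂ ∈ l}

/-- A subset `F ⊆ G` is right-connected: the subgraph of the right Cayley graph
induced on `F` is connected. -/
def RightConnected {r : ℕ} (F : Set (FG r)) : Prop :=
  ∀ g ∈ F, ∀ h ∈ F,
    Relation.ReflTransGen (fun a b => a ∈ F ∧ b ∈ F ∧ ∃ s ∈ Sset r, b = a * s) g h

/-- A subset `F ⊆ G` is left-connected: the subgraph of the left Cayley graph
induced on `F` is connected. -/
def LeftConnected {r : ℕ} (F : Set (FG r)) : Prop :=
  ∀ g ∈ F, ∀ h ∈ F,
    Relation.ReflTransGen (fun a b => a ∈ F ∧ b ∈ F ∧ ∃ s ∈ Sset r, b = s * a) g h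

section Markov

variable {X : Type*} [MeasurableSpace X] {K : Type*}

/-- A `G`-process `(T,X,μ,α)` is Markov: for every `s ∈ S`, `g ∈ G` and every atom
`A` of `α`, `μ(T_{sg}^{-1}A | ⋁_{f∈Past(sg;g)} T_f^{-1}α) = μ(T_{sg}^{-1}A | T_g^{-1}α)`
almost everywhere. -/
def IsMarkov {r : ℕ} (μ : Measure X) (T : FG r → X → X) (p : X → K) : Prop :=
  ∀ s ∈ Sset r, ∀ g : FG r, ∀ k : K,
    (μ[((pull T (s * g) p) ⁻¹' {k}).indicator (fun _ => (1:ℝ)) |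
        sAlgSet T p (Past (s * g) g)])
      =ᵐ[μ]
    (μ[((pull T (s * g) p) ⁻¹' {k}).indicator (fun _ => (1:ℝ)) |
        sAlg (pull T g p)])

end Markov


section ExtraDefs

/-- The distance `d₁` between two ordered processes:
`∑_{s∈S} ∑_{i,j} |μ(A_i ∩ T_s^{-1}A_j) − ν(B_i ∩ U_s^{-1}B_j)|`. -/
def d1 {X Y : Type*} [MeasurableSpace X] [MeasurableSpace Y] {r : ℕ}
    (T : FG r → X → X) (μ : Measure X) (α : X → ℕ)
    (U : FG r → Y → Y) (ν : Measure Y) (β : Y → ℕ) : ℝ :=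
  ∑ i : Fin r, ∑ b : Bool,
    ∑' ij : ℕ × ℕ,
      |(μ (α ⁻¹' {ij.1} ∩ pull T (gen (i, b)) α ⁻¹' {ij.2})).toReal -
        (ν (β ⁻¹' {ij.1} ∩ pull U (gen (i, b)) β ⁻¹' {ij.2})).toReal|

/-- Isomorphism of ordered processes: a measure conjugacy between conull sets
intertwining the actions and carrying the `i`-th atom to the `i`-th atom. -/
def OrderedIso {X Y : Type*} [MeasurableSpace X] [MeasurableSpace Y] {r : ℕ}
    (T : FG r → X → X) (μ : Measure X) (α : X → ℕ)
    (U : FG r → Y → Y) (ν : Measure Y) (β : Y → ℕ) : Prop :=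
  ∃ (X' : Set X) (Y' : Set Y) (φ : X → Y) (ψ : Y → X),
    MeasurableSet X' ∧ MeasurableSet Y' ∧ μ X'ᶜ = 0 ∧ ν Y'ᶜ = 0 ∧
    Measurable φ ∧ Measurable ψ ∧ Set.MapsTo φ X' Y' ∧ Set.MapsTo ψ Y' X' ∧
    (∀ x ∈ X', ψ (φ x) = x) ∧ (∀ y ∈ Y', φ (ψ y) = y) ∧
    Measure.map φ μ = ν ∧
    (∀ (g : FG r), ∀ x ∈ X', φ (T g x) = U g (φ x)) ∧
    (∀ x ∈ X', β (φ x) = α x)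

/-- A transition system for `(G,S)`: a family of `K × K` matrices indexed by the
generating set together with a row vector, written as functions. -/
structure TransSys (r : ℕ) (K : Type*) where
  P : Fin r × Bool → K → K → ℝ
  pi : K → ℝ

/-- The transition system is an invariant transition system: the `P^s` are
stochastic matrices, `π` is a probability vector which is a steady state vector
for every `P^s`, and `π_i P^{s^{-1}}_{ij} = π_j P^s_{ji}`. -/
def TransSys.IsInvariant {r : ℕ} {K : Type*} (ts : TransSys r K) : Prop :=
  (∀ s i j, 0 ≤ ts.P s i j) ∧ (∀ s i, HasSum (ts.P s i) 1) ∧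
    (∀ i, 0 ≤ ts.pi i) ∧ HasSum ts.pi 1 ∧
    (∀ s j, HasSum (fun i => ts.pi i * ts.P s i j) (ts.pi j)) ∧
    (∀ s i j, ts.pi i * ts.P (s.1, !s.2) i j = ts.pi j * ts.P s j i)

/-- The canonical (shift) action of `G` on `K^G`: `(T_g x)(f) = x(fg)`. -/
def shiftT {r : ℕ} {K : Type*} : FG r → (FG r → K) → (FG r → K) :=
  fun g x f => x (f * g)

/-- `μ` is (a measure) induced by the transition system `ts`: the time-`e`
distribution is `π` and the transition probabilities into the complement of the
past are given by the matrices `P^s`.  (Note `T_g^{-1}A_k = {x : x(g) = k}`;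
the conditional equalities `μ(A|B) = c` are recorded in the equivalent product
form `μ(A ∩ B) = c·μ(B)`.) -/
def IsInducedBy {r : ℕ} {K : Type*} [MeasurableSpace K]
    (μ : Measure (FG r → K)) (ts : TransSys r K) : Prop :=
  (∀ k : K, μ {x | x 1 = k} = ENNReal.ofReal (ts.pi k)) ∧
  ∀ (s : Fin r × Bool) (g : FG r),
    FreeGroup.norm (gen s * g) = FreeGroup.norm g + 1 →
    ∀ (n : ℕ) (fs : Fin n → FG r) (ks : Fin n → K) (k₀ k : K),
      (∀ i, fs i ∈ Past (gen s * g) g ∧ fs i ≠ g) →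
      (μ ({x | x (gen s * g) = k} ∩ ({x | x g = k₀} ∩ ⋂ i, {x | x (fs i) = ks i}))
          = ENNReal.ofReal (ts.P s k₀ k) * μ ({x | x g = k₀} ∩ ⋂ i, {x | x (fs i) = ks i})) ∧
      μ ({x | x (gen s * g) = k} ∩ {x | x g = k₀})
          = ENNReal.ofReal (ts.P s k₀ k) * μ {x | x g = k₀}

end ExtraDefs


section Ent

/-- `-log` in extended nonnegative form. -/
def Lg (a : ℝ≥0∞) : ℝ≥0∞ := ENNReal.ofReal (- Real.log a.toReal)

lemma Lg_one : Lg 1 = 0 := by simp [Lg]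

lemma negMulLog_eq (a : ℝ≥0∞) (ha : a ≤ 1) :
    ENNReal.ofReal (Real.negMulLog a.toReal) = a * Lg a := by
  have h : a ≠ ⊤ := ne_top_of_le_ne_top ENNReal.one_ne_top ha
  rw [Real.negMulLog, neg_mul, ← mul_neg, ENNReal.ofReal_mul ENNReal.toReal_nonneg, Lg,
    ENNReal.ofReal_toReal h]

lemma Lg_anti {a b : ℝ≥0∞} (ha : a ≠ 0) (hab : a ≤ b) (hb : b ≤ 1) : Lg b ≤ Lg a := by
  have hb' : b ≠ ⊤ := ne_top_of_le_ne_top ENNReal.one_ne_top hb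
  have ha' : a ≠ ⊤ := ne_top_of_le_ne_top hb' hab
  unfold Lg
  apply ENNReal.ofReal_le_ofReal
  apply neg_le_neg
  exact Real.log_le_log (ENNReal.toReal_pos ha ha') (ENNReal.toReal_mono hb' hab)

lemma Lg_measurable : Measurable Lg := by
  unfold Lg
  fun_prop

lemma key {t u v w : ℝ≥0∞} (ht : t ≤ 1) (hu : u ≤ 1) (hv : v ≤ 1) (hw : w ≤ 1)
    (hu0 : t ≠ 0 → u ≠ 0) (hv0 : t ≠ 0 → v ≠ 0) (hw0 : t ≠ 0 → w ≠ 0) :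
    t * Lg t + t * Lg w + t ≤ t * Lg u + t * Lg v + u * v / w := by
  by_cases h0 : t = 0
  · subst h0; simp
  have F : ∀ {a : ℝ≥0∞}, a ≤ 1 → a ≠ ⊤ := fun h => ne_top_of_le_ne_top ENNReal.one_ne_top h
  have P : ∀ {a : ℝ≥0∞}, a ≤ 1 → a ≠ 0 → 0 < a.toReal := fun h h' => ENNReal.toReal_pos h' (F h)
  have Q : ∀ {a : ℝ≥0∞}, a ≤ 1 → a ≠ 0 → 0 ≤ - Real.log a.toReal := by
    intro a h h'
    have : a.toReal ≤ 1 := by simpa using ENNReal.toReal_mono ENNReal.one_ne_top h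
    have := Real.log_nonpos (P h h').le this
    linarith
  have hu1 := hu0 h0
  have hv1 := hv0 h0
  have hw1 := hw0 h0
  have E1 : u * v / w = ENNReal.ofReal (u.toReal * v.toReal / w.toReal) := by
    rw [ENNReal.ofReal_div_of_pos (P hw hw1), ENNReal.ofReal_mul (P hu hu1).le,
      ENNReal.ofReal_toReal (F hu), ENNReal.ofReal_toReal (F hv), ENNReal.ofReal_toReal (F hw)]
  have E2 : ∀ {a : ℝ≥0∞}, t * Lg a = ENNReal.ofReal (t.toReal * - Real.log a.toReal) := by
    intro a
    rw [ENNReal.ofReal_mul (P ht h0).le, ENNReal.ofReal_toReal (F ht)]; rfl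
  have E3 : t = ENNReal.ofReal t.toReal := (ENNReal.ofReal_toReal (F ht)).symm
  have pt := P ht h0
  have pu := P hu hu1
  have pv := P hv hv1
  have pw := P hw hw1
  have qt := Q ht h0
  have qu := Q hu hu1
  have qv := Q hv hv1
  have qw := Q hw hw1
  rw [E1, E2, E2, E2, E2]
  nth_rewrite 4 [E3]
  rw [← ENNReal.ofReal_add (by positivity) (by positivity),
    ← ENNReal.ofReal_add (by positivity) (by positivity),
    ← ENNReal.ofReal_add (by positivity) (by positivity),
    ← ENNReal.ofReal_add (by positivity) (by positivity)]
  apply ENNReal.ofReal_le_ofReal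
  generalize t.toReal = t at *
  generalize u.toReal = u at *
  generalize v.toReal = v at *
  generalize w.toReal = w at *
  have h := Real.log_le_sub_one_of_pos (x := u * v / (w * t)) (by positivity)
  rw [Real.log_div (by positivity) (by positivity), Real.log_mul pu.ne' pv.ne',
    Real.log_mul pw.ne' pt.ne'] at h
  have h2 := mul_le_mul_of_nonneg_left h pt.le
  have h3 : t * (u * v / (w * t) - 1) = u * v / w - t := by field_simp
  rw [h3] at h2
  linarith

/-- Strong subadditivity in terms of arrays. -/
lemma ssa_array {I J K : Type*} (t : I → J → K → ℝ≥0∞) (hs : ∑' k, ∑' i, ∑' j, t i j k = 1) :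
    (∑' k, ∑' i, ∑' j, t i j k * Lg (t i j k))
      + (∑' k, (∑' i, ∑' j, t i j k) * Lg (∑' i, ∑' j, t i j k)) ≤
    (∑' k, ∑' i, (∑' j, t i j k) * Lg (∑' j, t i j k))
      + (∑' k, ∑' j, (∑' i, t i j k) * Lg (∑' i, t i j k)) := by
  set w : K → ℝ≥0∞ := fun k => ∑' i, ∑' j, t i j k with hw
  set u : I → K → ℝ≥0∞ := fun i k => ∑' j, t i j k with hu
  set v : J → K → ℝ≥0∞ := fun j k => ∑' i, t i j k with hv
  have hw' : ∀ k, w k = ∑' i, u i k := fun k => rfl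
  have hw'' : ∀ k, w k = ∑' j, v j k := fun k => ENNReal.tsum_comm
  have w1 : ∀ k, w k ≤ 1 := fun k => hs ▸ ENNReal.le_tsum (f := w) k
  have uw : ∀ i k, u i k ≤ w k := fun i k => ENNReal.le_tsum (f := fun i => u i k) i
  have vw : ∀ j k, v j k ≤ w k := fun j k => by
    rw [hw'']; exact ENNReal.le_tsum (f := fun j => v j k) j
  have tu : ∀ i j k, t i j k ≤ u i k := fun i j k => ENNReal.le_tsum (f := fun j => t i j k) j
  have tv : ∀ i j k, t i j k ≤ v j k := fun i j k => ENNReal.le_tsum (f := fun i => t i j k) i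
  have K1 : ∀ i j k, t i j k * Lg (t i j k) + t i j k * Lg (w k) + t i j k ≤
      t i j k * Lg (u i k) + t i j k * Lg (v j k) + u i k * v j k / w k := by
    intro i j k
    apply key ((tu i j k).trans ((uw i k).trans (w1 k))) ((uw i k).trans (w1 k))
      ((vw j k).trans (w1 k)) (w1 k)
    · exact fun h => (lt_of_lt_of_le (pos_iff_ne_zero.2 h) (tu i j k)).ne'
    · exact fun h => (lt_of_lt_of_le (pos_iff_ne_zero.2 h) (tv i j k)).ne'
    · exact fun h => (lt_of_lt_of_le (pos_iff_ne_zero.2 h) ((tu i j k).trans (uw i k))).ne'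
  have S : (∑' k, ∑' i, ∑' j, (t i j k * Lg (t i j k) + t i j k * Lg (w k) + t i j k)) ≤
      ∑' k, ∑' i, ∑' j, (t i j k * Lg (u i k) + t i j k * Lg (v j k) + u i k * v j k / w k) :=
    ENNReal.tsum_le_tsum fun k => ENNReal.tsum_le_tsum fun i => ENNReal.tsum_le_tsum fun j =>
      K1 i j k
  simp only [ENNReal.tsum_add] at S
  have A1 : ∑' k, ∑' i, ∑' j, t i j k * Lg (w k) = ∑' k, w k * Lg (w k) := by
    simp only [ENNReal.tsum_mul_right]; rfl
  have A2 : ∑' k, ∑' i, ∑' j, t i j k * Lg (u i k) = ∑' k, ∑' i, u i k * Lg (u i k) := by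
    simp only [ENNReal.tsum_mul_right]; rfl
  have A3 : ∑' k, ∑' i, ∑' j, t i j k * Lg (v j k) = ∑' k, ∑' j, v j k * Lg (v j k) := by
    refine tsum_congr fun k => ?_
    rw [ENNReal.tsum_comm]
    simp only [ENNReal.tsum_mul_right]; rfl
  have A4 : ∑' k, ∑' i, ∑' j, u i k * v j k / w k ≤ 1 := by
    rw [← hs]
    refine ENNReal.tsum_le_tsum fun k => ?_
    simp only [div_eq_mul_inv, mul_assoc, ENNReal.tsum_mul_left, ENNReal.tsum_mul_right,
      ← hw'', ← hw']
    calc w k * (w k * (w k)⁻¹) ≤ w k * 1 := by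
          gcongr; exact ENNReal.mul_inv_le_one _
      _ = w k := mul_one _
  rw [A1, A2, A3, hs] at S
  exact (ENNReal.add_le_add_iff_right ENNReal.one_ne_top).1 (S.trans (by gcongr))

end Ent


set_option linter.unusedSectionVars false

section HP
variable {X : Type*} [mX : MeasurableSpace X] {I J K : Type*} [Countable I] [Countable J]
  [Countable K]

/-- Measurable atoms. -/
def MA {K : Type*} (p : X → K) : Prop := ∀ k, MeasurableSet (p ⁻¹' {k})

/-- `p` refines `q` everywhere. -/
def Co {X K L : Type*} (p : X → K) (q : X → L) : Prop := ∀ x y, p x = p y → q x = q y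

lemma MA.set {p : X → K} (hp : MA p) (s : Set K) : MeasurableSet (p ⁻¹' s) := by
  have : p ⁻¹' s = ⋃ k ∈ s, p ⁻¹' {k} := by ext; simp
  rw [this]
  exact MeasurableSet.biUnion s.to_countable fun k _ => hp k

lemma pjoin_pre {p : X → I} {q : X → J} (a : I) (b : J) :
    pjoin p q ⁻¹' {(a, b)} = p ⁻¹' {a} ∩ q ⁻¹' {b} := by
  ext x; simp [pjoin]

lemma MA.pjoin {p : X → I} {q : X → J} (hp : MA p) (hq : MA q) : MA (pjoin p q) := by
  rintro ⟨a, b⟩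
  rw [pjoin_pre]
  exact (hp a).inter (hq b)

lemma MA.co {p : X → I} {q : X → J} (hp : MA p) (h : Co p q) : MA q := by
  intro k
  have : q ⁻¹' {k} = p ⁻¹' (p '' (q ⁻¹' {k})) := by
    ext x
    constructor
    · intro hx; exact ⟨x, hx, rfl⟩
    · rintro ⟨y, hy, hxy⟩
      have := h _ _ hxy
      simp only [Set.mem_preimage, Set.mem_singleton_iff] at *
      rw [← this, hy]
  rw [this]
  exact hp.set _

lemma tsum_inter (ν : Measure X) {p : X → I} (hp : MA p) (A : Set X) :
    ∑' k, ν (A ∩ p ⁻¹' {k}) = ν A := by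
  have h : ∀ k, ν (A ∩ p ⁻¹' {k}) = ν.restrict A (p ⁻¹' {k}) := by
    intro k
    rw [Measure.restrict_apply (hp k), Set.inter_comm]
  simp only [h]
  rw [← measure_iUnion _ hp]
  · have : ⋃ k, p ⁻¹' {k} = Set.univ := by ext; simp
    rw [this, Measure.restrict_apply_univ]
  · intro a b hab
    rw [Function.onFun, Set.disjoint_left]
    intro x hx hx'
    simp at hx hx'
    exact hab (hx ▸ hx')

lemma tsum_atoms (ν : Measure X) {p : X → I} (hp : MA p) :
    ∑' k, ν (p ⁻¹' {k}) = ν Set.univ := by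
  have := tsum_inter ν hp Set.univ
  simpa using this

lemma Hpart_eq (ν : Measure X) [IsProbabilityMeasure ν] (p : X → I) :
    Hpart ν p = ∑' k, ν (p ⁻¹' {k}) * Lg (ν (p ⁻¹' {k})) := by
  unfold Hpart
  exact tsum_congr fun k => negMulLog_eq _ prob_le_one

lemma Hpart_mono (ν : Measure X) [IsProbabilityMeasure ν] {p : X → I} {q : X → J} (hp : MA p)
    (h : Co p q) : Hpart ν q ≤ Hpart ν p := by
  have hq := hp.co h
  rw [Hpart_eq, Hpart_eq]
  calc ∑' l, ν (q ⁻¹' {l}) * Lg (ν (q ⁻¹' {l}))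
      = ∑' l, ∑' k, ν (q ⁻¹' {l} ∩ p ⁻¹' {k}) * Lg (ν (q ⁻¹' {l})) := by
        refine tsum_congr fun l => ?_
        rw [ENNReal.tsum_mul_right, tsum_inter ν hp]
    _ ≤ ∑' l, ∑' k, ν (q ⁻¹' {l} ∩ p ⁻¹' {k}) * Lg (ν (p ⁻¹' {k})) := by
        refine ENNReal.tsum_le_tsum fun l => ENNReal.tsum_le_tsum fun k => ?_
        by_cases h0 : ν (q ⁻¹' {l} ∩ p ⁻¹' {k}) = 0
        · simp [h0]
        gcongr
        obtain ⟨x, hx1, hx2⟩ := nonempty_of_measure_ne_zero h0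
        apply Lg_anti
        · exact fun h1 => h0 (measure_mono_null Set.inter_subset_right h1)
        · apply measure_mono
          intro y hy
          simp only [Set.mem_preimage, Set.mem_singleton_iff] at *
          rw [← hx1]
          exact h _ _ (hy.trans hx2.symm)
        · exact prob_le_one
    _ = ∑' k, ∑' l, ν (p ⁻¹' {k} ∩ q ⁻¹' {l}) * Lg (ν (p ⁻¹' {k})) := by
        rw [ENNReal.tsum_comm]
        simp only [Set.inter_comm]
    _ = ∑' k, ν (p ⁻¹' {k}) * Lg (ν (p ⁻¹' {k})) := by
        refine tsum_congr fun l => ?_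
        rw [ENNReal.tsum_mul_right, tsum_inter ν hq]

lemma Hpart_ssa (ν : Measure X) [IsProbabilityMeasure ν] {p : X → I} {q : X → J} {w : X → K}
    (hp : MA p) (hq : MA q) (hw : MA w) :
    Hpart ν (pjoin w (pjoin p q)) + Hpart ν w ≤ Hpart ν (pjoin w p) + Hpart ν (pjoin w q) := by
  rw [Hpart_eq, Hpart_eq, Hpart_eq, Hpart_eq]
  simp only [ENNReal.tsum_prod', pjoin_pre]
  set t : I → J → K → ℝ≥0∞ := fun i j k => ν (w ⁻¹' {k} ∩ (p ⁻¹' {i} ∩ q ⁻¹' {j})) with ht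
  have h1 : ∀ i k, ν (w ⁻¹' {k} ∩ p ⁻¹' {i}) = ∑' j, t i j k := by
    intro i k
    rw [← tsum_inter ν hq]
    simp only [ht, Set.inter_assoc]
  have h2 : ∀ j k, ν (w ⁻¹' {k} ∩ q ⁻¹' {j}) = ∑' i, t i j k := by
    intro j k
    rw [← tsum_inter ν hp]
    refine tsum_congr fun i => ?_
    simp only [ht, Set.inter_assoc]
    rw [Set.inter_comm (q ⁻¹' {j})]
  have h3 : ∀ k, ν (w ⁻¹' {k}) = ∑' i, ∑' j, t i j k := by
    intro k
    rw [← tsum_inter ν hp]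
    simp only [h1]
  have h4 : ∑' k, ∑' i, ∑' j, t i j k = 1 := by
    simp only [← h3]
    rw [tsum_atoms ν hw, measure_univ]
  have := ssa_array t h4
  simp only [h1, h2, h3]
  exact this

lemma Hpart_submod {L : Type*} [Countable L] (ν : Measure X) [IsProbabilityMeasure ν]
    {p : X → I} {q : X → J} {w : X → K} {d : X → L}
    (hp : MA p) (hq : MA q) (hpw : Co p w) (hqw : Co q w) (hd : Co (pjoin p q) d) :
    Hpart ν d + Hpart ν w ≤ Hpart ν p + Hpart ν q := by
  have hw := hp.co hpw
  calc Hpart ν d + Hpart ν w ≤ Hpart ν (pjoin w (pjoin p q)) + Hpart ν w := by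
        gcongr
        apply Hpart_mono ν (hw.pjoin (hp.pjoin hq))
        intro x y hxy
        apply hd
        simp only [pjoin, Prod.mk.injEq] at *
        exact hxy.2
    _ ≤ _ := Hpart_ssa ν hp hq hw
    _ ≤ _ := by
        gcongr
        · apply Hpart_mono ν hp
          intro x y hxy
          simp only [pjoin, Prod.mk.injEq]
          exact ⟨hpw _ _ hxy, hxy⟩
        · apply Hpart_mono ν hq
          intro x y hxy
          simp only [pjoin, Prod.mk.injEq]
          exact ⟨hqw _ _ hxy, hxy⟩

end HP

set_option linter.unusedSectionVars false
section HC
open ProbabilityTheory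
variable {X : Type*} {m : MeasurableSpace X} [mX : MeasurableSpace X] [StandardBorelSpace X]
  {I J K : Type*} [Countable I] [Countable J] [Countable K]

lemma lint_cond (μ : Measure X) [IsProbabilityMeasure μ] (hm : m ≤ mX)
    {A : Set X} (hA : MeasurableSet A) {ψ : X → ℝ≥0∞} (hψ : Measurable[m] ψ) :
    ∫⁻ x in A, ψ x ∂μ = ∫⁻ x, condExpKernel μ m x A * ψ x ∂μ := by
  have h := compProd_trim_condExpKernel (μ := μ) hm
  have hf : @Measurable (X × X) ℝ≥0∞ (m.prod mX) _
      (fun z => A.indicator (fun _ => (1 : ℝ≥0∞)) z.2 * ψ z.1) := by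
    refine @Measurable.mul _ _ _ _ (m.prod mX) _ _ _ ?_ ?_
    · exact (measurable_const.indicator hA).comp (@measurable_snd _ _ m mX)
    · exact hψ.comp (@measurable_fst _ _ m mX)
  have hdg : @Measurable X (X × X) mX (m.prod mX) Function.diag :=
    Measurable.prodMk (measurable_id'' hm) measurable_id
  have h1 := congrArg (fun (M : @Measure (X × X) (m.prod mX)) =>
    @lintegral _ (m.prod mX) M (fun z => A.indicator (fun _ => (1 : ℝ≥0∞)) z.2 * ψ z.1)) h
  rw [@Measure.lintegral_compProd _ _ m mX _ _ _ _ _ hf,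
    @lintegral_map _ _ mX (m.prod mX) _ _ _ hf hdg] at h1
  have h2 : ∀ x, ∫⁻ y, A.indicator (fun _ => (1 : ℝ≥0∞)) y * ψ x ∂(condExpKernel μ m x)
      = condExpKernel μ m x A * ψ x := by
    intro x
    rw [lintegral_mul_const _ (measurable_const.indicator hA), lintegral_indicator_const hA,
      one_mul]
  simp only [h2] at h1
  rw [lintegral_trim hm ((measurable_condExpKernel hA).fun_mul hψ)] at h1
  rw [h1, ← lintegral_indicator hA]
  refine lintegral_congr fun x => ?_
  by_cases hx : x ∈ A <;> simp [hx, Function.diag]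

lemma lint_kernel (μ : Measure X) [IsProbabilityMeasure μ] (hm : m ≤ mX)
    {A : Set X} (hA : MeasurableSet A) :
    ∫⁻ x, condExpKernel μ m x A ∂μ = μ A := by
  have := lint_cond μ hm hA (ψ := fun _ => 1) measurable_const
  simpa using this.symm

lemma meas_kernel (μ : Measure X) [IsProbabilityMeasure μ] (hm : m ≤ mX)
    {A : Set X} (hA : MeasurableSet A) : Measurable (fun x => condExpKernel μ m x A) :=
  (measurable_condExpKernel hA).mono hm le_rfl

lemma kernel_ae (μ : Measure X) [IsProbabilityMeasure μ] (hm : m ≤ mX)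
    {A : Set X} (hA : MeasurableSet A) :
    ∀ᵐ x ∂μ, (μ[A.indicator (fun _ => (1:ℝ)) | m]) x = (condExpKernel μ m x A).toReal := by
  filter_upwards [condExpKernel_ae_eq_condExp (μ := μ) hm hA] with x hx
  exact hx.symm

lemma HpartC_eq (μ : Measure X) [IsProbabilityMeasure μ] (hm : m ≤ mX)
    {p : X → I} (hp : MA p) :
    HpartC μ p m = ∫⁻ x, Hpart (condExpKernel μ m x) p ∂μ := by
  have h0 : ∀ᵐ x ∂μ, ∀ k, (μ[(p ⁻¹' {k}).indicator (fun _ => (1:ℝ)) | m]) x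
      = (condExpKernel μ m x (p ⁻¹' {k})).toReal :=
    ae_all_iff.2 fun k => kernel_ae μ hm (hp k)
  have hmeas : ∀ k, Measurable[m] fun x => Lg (condExpKernel μ m x (p ⁻¹' {k})) :=
    fun k => Lg_measurable.comp (measurable_condExpKernel (hp k))
  have h1 : HpartC μ p m = ∫⁻ x, ∑' k, (p ⁻¹' {k}).indicator
      (fun x => Lg (condExpKernel μ m x (p ⁻¹' {k}))) x ∂μ := by
    unfold HpartC
    apply lintegral_congr_ae
    filter_upwards [h0] with x hx
    rw [tsum_eq_single (p x)]
    · rw [Set.indicator_of_mem (by simp)]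
      unfold atomOf Lg
      rw [hx]
    · intro k hk
      rw [Set.indicator_of_notMem]
      simpa using fun h => hk h.symm
  rw [h1, lintegral_tsum (fun k => (((hmeas k).mono hm le_rfl).indicator (hp k)).aemeasurable)]
  simp only [Hpart_eq]
  rw [lintegral_tsum (fun k => ((meas_kernel μ hm (hp k)).fun_mul
    (Lg_measurable.fun_comp (meas_kernel μ hm (hp k)))).aemeasurable)]
  refine tsum_congr fun k => ?_
  rw [lintegral_indicator (hp k), lint_cond μ hm (hp k) (hmeas k)]

lemma meas_Hpart (μ : Measure X) [IsProbabilityMeasure μ] (hm : m ≤ mX)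
    {p : X → I} (hp : MA p) : Measurable fun x => Hpart (condExpKernel μ m x) p := by
  simp only [Hpart_eq]
  exact Measurable.tsum fun k => ((meas_kernel μ hm (hp k)).fun_mul
    (Lg_measurable.fun_comp (meas_kernel μ hm (hp k))))

lemma HpartC_mono (μ : Measure X) [IsProbabilityMeasure μ] (hm : m ≤ mX)
    {p : X → I} {q : X → J} (hp : MA p)
    (h : Co p q) : HpartC μ q m ≤ HpartC μ p m := by
  rw [HpartC_eq μ hm hp, HpartC_eq μ hm (hp.co h)]
  exact lintegral_mono fun x => Hpart_mono _ hp h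

lemma HpartC_submod {L : Type*} [Countable L] (μ : Measure X) [IsProbabilityMeasure μ] (hm : m ≤ mX)
    {p : X → I} {q : X → J} {w : X → K} {d : X → L}
    (hp : MA p) (hq : MA q) (hpw : Co p w) (hqw : Co q w) (hd : Co (pjoin p q) d) :
    HpartC μ d m + HpartC μ w m ≤ HpartC μ p m + HpartC μ q m := by
  have hw := hp.co hpw
  have hd' := (hp.pjoin hq).co hd
  rw [HpartC_eq μ hm hp, HpartC_eq μ hm hq, HpartC_eq μ hm hw, HpartC_eq μ hm hd',
    ← lintegral_add_left (meas_Hpart μ hm hd'), ← lintegral_add_left (meas_Hpart μ hm hp)]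
  exact lintegral_mono fun x => Hpart_submod _ hp hq hpw hqw hd

/-- Conditioning on more decreases entropy, in a subtraction-free form. -/
lemma HpartC_mix (μ : Measure X) [IsProbabilityMeasure μ] (hm : m ≤ mX) {p : X → I} {w : X → K} (hp : MA p) (hw : MA w) :
    HpartC μ (pjoin w p) m + Hpart μ w ≤ HpartC μ w m + Hpart μ (pjoin w p) := by
  set κ := condExpKernel μ m with hκ
  have hwp : ∀ k i, MeasurableSet (w ⁻¹' {k} ∩ p ⁻¹' {i}) := fun k i => (hw k).inter (hp i)
  have hz : ∀ᵐ x ∂μ, ∀ k i, μ (w ⁻¹' {k} ∩ p ⁻¹' {i}) = 0 → κ x (w ⁻¹' {k} ∩ p ⁻¹' {i}) = 0 := by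
    refine ae_all_iff.2 fun k => ae_all_iff.2 fun i => ?_
    by_cases h : μ (w ⁻¹' {k} ∩ p ⁻¹' {i}) = 0
    · have h' := lint_kernel μ hm (hwp k i)
      rw [h, lintegral_eq_zero_iff (meas_kernel μ hm (hwp k i))] at h'
      filter_upwards [h'] with x hx _
      exact hx
    · exact Eventually.of_forall fun x hx => absurd hx h
  have S : ∫⁻ x, ∑' k, ∑' i, (κ x (w ⁻¹' {k} ∩ p ⁻¹' {i}) * Lg (κ x (w ⁻¹' {k} ∩ p ⁻¹' {i}))
        + κ x (w ⁻¹' {k} ∩ p ⁻¹' {i}) * Lg (μ (w ⁻¹' {k})) + κ x (w ⁻¹' {k} ∩ p ⁻¹' {i})) ∂μ ≤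
      ∫⁻ x, ∑' k, ∑' i, (κ x (w ⁻¹' {k} ∩ p ⁻¹' {i}) * Lg (κ x (w ⁻¹' {k}))
        + κ x (w ⁻¹' {k} ∩ p ⁻¹' {i}) * Lg (μ (w ⁻¹' {k} ∩ p ⁻¹' {i}))
        + κ x (w ⁻¹' {k}) * μ (w ⁻¹' {k} ∩ p ⁻¹' {i}) / μ (w ⁻¹' {k})) ∂μ := by
    apply lintegral_mono_ae
    filter_upwards [hz] with x hx
    refine ENNReal.tsum_le_tsum fun k => ENNReal.tsum_le_tsum fun i => ?_
    apply key prob_le_one prob_le_one prob_le_one prob_le_one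
    · exact fun h1 h2 => h1 (measure_mono_null Set.inter_subset_left h2)
    · exact fun h1 h2 => h1 (hx _ _ h2)
    · exact fun h1 h2 => h1 (hx _ _ (measure_mono_null Set.inter_subset_left h2))
  have mk : ∀ k, Measurable fun x => κ x (w ⁻¹' {k}) := fun k => meas_kernel μ hm (hw k)
  have mki : ∀ k i, Measurable fun x => κ x (w ⁻¹' {k} ∩ p ⁻¹' {i}) :=
    fun k i => meas_kernel μ hm (hwp k i)
  have mL : ∀ {f : X → ℝ≥0∞}, Measurable f → Measurable fun x => Lg (f x) :=
    fun h => Lg_measurable.comp h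
  simp only [ENNReal.tsum_add] at S
  have M1 : Measurable fun x => ∑' k, ∑' i,
      κ x (w ⁻¹' {k} ∩ p ⁻¹' {i}) * Lg (κ x (w ⁻¹' {k} ∩ p ⁻¹' {i})) :=
    Measurable.tsum fun k => Measurable.tsum fun i => (mki k i).mul (mL (mki k i))
  have M2 : Measurable fun x => ∑' k, ∑' i,
      κ x (w ⁻¹' {k} ∩ p ⁻¹' {i}) * Lg (μ (w ⁻¹' {k})) :=
    Measurable.tsum fun k => Measurable.tsum fun i => (mki k i).mul_const _
  have M3 : Measurable fun x => ∑' k, ∑' i,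
      κ x (w ⁻¹' {k} ∩ p ⁻¹' {i}) * Lg (κ x (w ⁻¹' {k})) :=
    Measurable.tsum fun k => Measurable.tsum fun i => (mki k i).mul (mL (mk k))
  have M4 : Measurable fun x => ∑' k, ∑' i,
      κ x (w ⁻¹' {k} ∩ p ⁻¹' {i}) * Lg (μ (w ⁻¹' {k} ∩ p ⁻¹' {i})) :=
    Measurable.tsum fun k => Measurable.tsum fun i => (mki k i).mul_const _
  rw [lintegral_add_left (M1.fun_add M2), lintegral_add_left M1, lintegral_add_left (M3.fun_add M4),
    lintegral_add_left M3] at S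
  have B1 : ∫⁻ x, ∑' k, ∑' i,
      κ x (w ⁻¹' {k} ∩ p ⁻¹' {i}) * Lg (κ x (w ⁻¹' {k} ∩ p ⁻¹' {i})) ∂μ
      = HpartC μ (pjoin w p) m := by
    rw [HpartC_eq μ hm (hw.pjoin hp)]
    simp only [Hpart_eq, ENNReal.tsum_prod', pjoin_pre, hκ]
  have B2 : ∫⁻ x, ∑' k, ∑' i, κ x (w ⁻¹' {k} ∩ p ⁻¹' {i}) * Lg (μ (w ⁻¹' {k})) ∂μ
      = Hpart μ w := by
    simp only [Hpart_eq, ENNReal.tsum_mul_right, tsum_inter _ hp]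
    rw [lintegral_tsum fun k => ((mk k).mul_const _).aemeasurable]
    refine tsum_congr fun k => ?_
    rw [lintegral_mul_const _ (mk k), lint_kernel μ hm (hw k)]
  have B3 : ∫⁻ x, ∑' k, ∑' i, κ x (w ⁻¹' {k} ∩ p ⁻¹' {i}) * Lg (κ x (w ⁻¹' {k})) ∂μ
      = HpartC μ w m := by
    rw [HpartC_eq μ hm hw]
    simp only [Hpart_eq, ENNReal.tsum_mul_right, tsum_inter _ hp, hκ]
  have B4 : ∫⁻ x, ∑' k, ∑' i,
      κ x (w ⁻¹' {k} ∩ p ⁻¹' {i}) * Lg (μ (w ⁻¹' {k} ∩ p ⁻¹' {i})) ∂μ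
      = Hpart μ (pjoin w p) := by
    simp only [Hpart_eq, ENNReal.tsum_prod', pjoin_pre]
    rw [lintegral_tsum fun k => (Measurable.tsum fun i =>
      (mki k i).mul_const _).aemeasurable]
    refine tsum_congr fun k => ?_
    rw [lintegral_tsum fun i => ((mki k i).mul_const _).aemeasurable]
    refine tsum_congr fun i => ?_
    rw [lintegral_mul_const _ (mki k i), lint_kernel μ hm (hwp k i)]
  have B5 : ∫⁻ x, ∑' k, ∑' i, κ x (w ⁻¹' {k} ∩ p ⁻¹' {i}) ∂μ = 1 := by
    simp only [tsum_inter _ hp, tsum_atoms _ hw, measure_univ, lintegral_const, mul_one]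
  have B6 : ∫⁻ x, ∑' k, ∑' i,
      κ x (w ⁻¹' {k}) * μ (w ⁻¹' {k} ∩ p ⁻¹' {i}) / μ (w ⁻¹' {k}) ∂μ ≤ 1 := by
    simp only [div_eq_mul_inv, mul_assoc, ENNReal.tsum_mul_left, ENNReal.tsum_mul_right,
      tsum_inter _ hp]
    rw [lintegral_tsum fun k => ((mk k).mul_const _).aemeasurable]
    calc _ ≤ ∑' k, μ (w ⁻¹' {k}) := by
          refine ENNReal.tsum_le_tsum fun k => ?_
          rw [lintegral_mul_const _ (mk k), lint_kernel μ hm (hw k)]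
          calc _ ≤ μ (w ⁻¹' {k}) * 1 := by
                gcongr; exact ENNReal.mul_inv_le_one _
            _ = _ := mul_one _
      _ = 1 := by rw [tsum_atoms _ hw, measure_univ]
  rw [B1, B2, B3, B4, B5] at S
  exact (ENNReal.add_le_add_iff_right ENNReal.one_ne_top).1 (S.trans (by gcongr))

lemma Hpart_unit (ν : Measure X) [IsProbabilityMeasure ν] : Hpart ν (fun _ : X => ()) = 0 := by
  simp [Hpart]

lemma HpartC_le (μ : Measure X) [IsProbabilityMeasure μ] (hm : m ≤ mX) {p : X → I} (hp : MA p) :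
    HpartC μ p m ≤ Hpart μ p := by
  have hu : MA (fun _ : X => ()) := fun k => by simp
  have h := HpartC_mix μ hm hp hu
  rw [Hpart_unit, HpartC_eq μ hm hu] at h
  simp only [Hpart_unit, lintegral_zero, add_zero, zero_add] at h
  calc _ ≤ HpartC μ (pjoin (fun _ : X => ()) p) m :=
        HpartC_mono μ hm (hu.pjoin hp) (fun x y h => by simpa [pjoin] using h)
    _ ≤ _ := h
    _ ≤ _ := Hpart_mono μ hp (fun x y h => by simpa [pjoin] using h)

end HC

set_option linter.unusedSectionVars false
section HD
open ProbabilityTheory Topology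
variable {X : Type*} {m : MeasurableSpace X} [mX : MeasurableSpace X]
  {I J K : Type*} [Countable I] [Countable J] [Countable K]

lemma HpartC_pull (μ : Measure X) [IsProbabilityMeasure μ] (hm : m ≤ mX) {S S' : X → X}
    (hS : MeasurePreserving S μ μ) (hS' : Measurable S') (h1 : ∀ x, S (S' x) = x)
    (h2 : ∀ x, S' (S x) = x) (hmS : Measurable[m, m] S) (hmS' : Measurable[m, m] S')
    {p : X → I} (hp : MA p) :
    HpartC μ (fun x => p (S x)) m = HpartC μ p m := by
  have hemb : MeasurableEmbedding S := by
    let e : X ≃ᵐ X := ⟨⟨S, S', h2, h1⟩, hS.measurable, hS'⟩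
    exact e.measurableEmbedding
  have hc : ∀ k, ∀ᵐ x ∂μ, (μ[(p ⁻¹' {k}).indicator (fun _ => (1:ℝ)) | m]) (S x)
      = (μ[((fun x => p (S x)) ⁻¹' {k}).indicator (fun _ => (1:ℝ)) | m]) x := by
    intro k
    have hk := hp k
    have hi : Integrable ((p ⁻¹' {k}).indicator (fun _ => (1:ℝ))) μ :=
      (integrable_const _).indicator hk
    have hk' : MeasurableSet ((fun x => p (S x)) ⁻¹' {k}) := hS.measurable hk
    have hi' : Integrable (((fun x => p (S x)) ⁻¹' {k}).indicator (fun _ => (1:ℝ))) μ :=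
      (integrable_const _).indicator hk'
    refine ae_eq_condExp_of_forall_setIntegral_eq hm hi' ?_ ?_ ?_
    · intro s _ _
      exact ((hS.integrable_comp_emb hemb).2 integrable_condExp).integrableOn
    · intro s hs _
      have es : s = S ⁻¹' (S' ⁻¹' s) := by ext x; simp [h2]
      rw [es, hS.setIntegral_preimage_emb hemb (fun x => (μ[(p ⁻¹' {k}).indicator (fun _ => (1:ℝ)) | m]) x),
        setIntegral_condExp hm hi (hmS' hs), ← hS.setIntegral_preimage_emb hemb]
      rfl
    · exact (stronglyMeasurable_condExp.comp_measurable hmS).aestronglyMeasurable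
  have hc' := ae_all_iff.2 hc
  unfold HpartC
  rw [← hS.lintegral_comp_emb hemb (fun x => ENNReal.ofReal
    (- Real.log ((μ[(atomOf p x).indicator (fun _ => (1:ℝ)) | m]) x)))]
  apply lintegral_congr_ae
  filter_upwards [hc'] with x hx
  have := hx (p (S x))
  unfold atomOf
  rw [this]

lemma Hpart_pull (μ : Measure X) {S : X → X}
    (hS : MeasurePreserving S μ μ) {p : X → I} (hp : MA p) :
    Hpart μ (fun x => p (S x)) = Hpart μ p := by
  unfold Hpart
  refine tsum_congr fun k => ?_
  rw [← hS.measure_preimage (hp k).nullMeasurableSet]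
  rfl

lemma sAlg_le {w : X → K} (hw : MA w) : sAlg w ≤ mX := by
  rintro s ⟨t, -, rfl⟩
  exact hw.set t

variable [StandardBorelSpace X]

lemma Hpart_chain (μ : Measure X) [IsProbabilityMeasure μ] {w : X → K} {p : X → I} (hw : MA w)
    (hp : MA p) :
    Hpart μ (pjoin w p) ≤ Hpart μ w + HpartC μ p (sAlg w) := by
  have hm := sAlg_le hw
  rw [HpartC_eq μ hm hp, Hpart_eq, Hpart_eq]
  simp only [Hpart_eq]
  set κ := condExpKernel μ (sAlg w) with hκ
  have mk : ∀ i, Measurable fun x => κ x (p ⁻¹' {i}) := fun i => meas_kernel μ hm (hp i)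
  have hconst : ∀ i x y, w x = w y → κ x (p ⁻¹' {i}) = κ y (p ⁻¹' {i}) := by
    intro i x y hxy
    have : Measurable[sAlg w] fun x => κ x (p ⁻¹' {i}) := measurable_condExpKernel (hp i)
    obtain ⟨t, -, ht⟩ := this (measurableSet_singleton (κ y (p ⁻¹' {i})))
    have hy : y ∈ w ⁻¹' t := by rw [ht]; simp
    have hx : x ∈ w ⁻¹' t := by
      simp only [Set.mem_preimage] at *; rw [hxy]; exact hy
    rw [ht] at hx
    simpa using hx
  have h_inter : ∀ k i, ∫⁻ x in w ⁻¹' {k}, κ x (p ⁻¹' {i}) ∂μ = μ (w ⁻¹' {k} ∩ p ⁻¹' {i}) := by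
    intro k i
    have hmk : MeasurableSet[sAlg w] (w ⁻¹' {k}) := ⟨{k}, trivial, rfl⟩
    have := lint_cond μ hm (hp i) (ψ := (w ⁻¹' {k}).indicator fun _ => 1)
      (measurable_const.indicator hmk)
    rw [lintegral_indicator_const (hw k), one_mul, Measure.restrict_apply (hw k)] at this
    rw [this, ← lintegral_indicator (hw k)]
    refine lintegral_congr fun x => ?_
    by_cases hx : x ∈ w ⁻¹' {k} <;> simp [hx, hκ]
  have hE : ∀ k i, μ (w ⁻¹' {k} ∩ p ⁻¹' {i}) * Lg (μ (w ⁻¹' {k} ∩ p ⁻¹' {i})) ≤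
      μ (w ⁻¹' {k} ∩ p ⁻¹' {i}) * Lg (μ (w ⁻¹' {k})) +
        ∫⁻ x in w ⁻¹' {k}, κ x (p ⁻¹' {i}) * Lg (κ x (p ⁻¹' {i})) ∂μ := by
    intro k i
    by_cases h0 : μ (w ⁻¹' {k} ∩ p ⁻¹' {i}) = 0
    · simp [h0]
    obtain ⟨y, hy, -⟩ := nonempty_of_measure_ne_zero h0
    have hcy : ∀ x ∈ w ⁻¹' {k}, κ x (p ⁻¹' {i}) = κ y (p ⁻¹' {i}) := by
      intro x hx
      apply hconst
      simp only [Set.mem_preimage, Set.mem_singleton_iff] at hx hy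
      rw [hx, hy]
    have e1 : μ (w ⁻¹' {k} ∩ p ⁻¹' {i}) = κ y (p ⁻¹' {i}) * μ (w ⁻¹' {k}) := by
      rw [← h_inter, setLIntegral_congr_fun (hw k) hcy, setLIntegral_const]
    have e2 : ∫⁻ x in w ⁻¹' {k}, κ x (p ⁻¹' {i}) * Lg (κ x (p ⁻¹' {i})) ∂μ =
        κ y (p ⁻¹' {i}) * Lg (κ y (p ⁻¹' {i})) * μ (w ⁻¹' {k}) := by
      rw [setLIntegral_congr_fun (g := fun _ => κ y (p ⁻¹' {i}) * Lg (κ y (p ⁻¹' {i}))) (hw k)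
        (fun x hx => by simp only [hcy x hx]), setLIntegral_const]
    rw [e2]
    rw [e1] at h0 ⊢
    have hc0 : κ y (p ⁻¹' {i}) ≠ 0 := left_ne_zero_of_mul h0
    have hb0 : μ (w ⁻¹' {k}) ≠ 0 := right_ne_zero_of_mul h0
    have hl : Lg (κ y (p ⁻¹' {i}) * μ (w ⁻¹' {k})) ≤
        Lg (κ y (p ⁻¹' {i})) + Lg (μ (w ⁻¹' {k})) := by
      unfold Lg
      rw [ENNReal.toReal_mul, Real.log_mul (ENNReal.toReal_ne_zero.2 ⟨hc0, measure_ne_top _ _⟩)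
        (ENNReal.toReal_ne_zero.2 ⟨hb0, measure_ne_top _ _⟩), neg_add]
      exact ENNReal.ofReal_add_le
    calc _ ≤ κ y (p ⁻¹' {i}) * μ (w ⁻¹' {k}) * (Lg (κ y (p ⁻¹' {i})) + Lg (μ (w ⁻¹' {k}))) := by
          gcongr
      _ = _ := by ring
  have mE : ∀ i, Measurable fun x => κ x (p ⁻¹' {i}) * Lg (κ x (p ⁻¹' {i})) :=
    fun i => (mk i).fun_mul (Lg_measurable.fun_comp (mk i))
  simp only [ENNReal.tsum_prod', pjoin_pre]
  calc _ ≤ ∑' k, ∑' i, (μ (w ⁻¹' {k} ∩ p ⁻¹' {i}) * Lg (μ (w ⁻¹' {k})) +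
        ∫⁻ x in w ⁻¹' {k}, κ x (p ⁻¹' {i}) * Lg (κ x (p ⁻¹' {i})) ∂μ) :=
        ENNReal.tsum_le_tsum fun k => ENNReal.tsum_le_tsum fun i => hE k i
    _ = _ := by
        simp only [ENNReal.tsum_add, ENNReal.tsum_mul_right, tsum_inter μ hp]
        congr 1
        rw [lintegral_tsum fun i => (mE i).aemeasurable, ENNReal.tsum_comm]
        refine tsum_congr fun i => ?_
        have : ∀ k, ∫⁻ x in w ⁻¹' {k}, κ x (p ⁻¹' {i}) * Lg (κ x (p ⁻¹' {i})) ∂μ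
            = (μ.withDensity fun x => κ x (p ⁻¹' {i}) * Lg (κ x (p ⁻¹' {i}))) (w ⁻¹' {k}) :=
          fun k => (withDensity_apply _ (hw k)).symm
        simp only [this]
        rw [tsum_atoms _ hw, withDensity_apply _ MeasurableSet.univ, Measure.restrict_univ]

lemma ent_bound (μ : Measure X) [IsProbabilityMeasure μ] (hm : m ≤ mX) {B : Set X}
    (hB : MeasurableSet B) :
    ∫⁻ x, condExpKernel μ m x B * Lg (condExpKernel μ m x B) ∂μ ≤ μ B * Lg (μ B) := by
  set κ := condExpKernel μ m with hκ
  have hmk : Measurable fun x => κ x B := meas_kernel μ hm hB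
  have hz : ∀ᵐ x ∂μ, μ B = 0 → κ x B = 0 := by
    by_cases h : μ B = 0
    · have h' := lint_kernel μ hm hB
      rw [h, lintegral_eq_zero_iff (meas_kernel μ hm hB)] at h'
      filter_upwards [h'] with x hx _
      exact hx
    · exact Eventually.of_forall fun x hx => absurd hx h
  have S : ∫⁻ x, (κ x B * Lg (κ x B) + κ x B) ∂μ ≤ ∫⁻ x, (κ x B * Lg (μ B) + μ B) ∂μ := by
    apply lintegral_mono_ae
    filter_upwards [hz] with x hx
    have := key (t := κ x B) (u := 1) (v := μ B) (w := 1) prob_le_one le_rfl prob_le_one le_rfl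
      (by simp) (fun h1 h2 => h1 (hx h2)) (by simp)
    simpa [Lg_one] using this
  rw [lintegral_add_right _ hmk, lintegral_add_right _ measurable_const,
    lintegral_mul_const _ hmk, lint_kernel μ hm hB] at S
  simp only [lintegral_const, measure_univ, mul_one] at S
  exact (ENNReal.add_le_add_iff_right (measure_ne_top _ _)).1 S

lemma gen_tendsto (μ : Measure X) [IsProbabilityMeasure μ] {W : ℕ → Type*}
    [∀ n, Countable (W n)] (w : ∀ n, X → W n) (hw : ∀ n, MA (w n))
    (hmono : ∀ i j, i ≤ j → Co (w j) (w i))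
    (hgen : ∀ A : Set X, MeasurableSet A →
      ∃ A' : Set X, MeasurableSet[⨆ n, sAlg (w n)] A' ∧ μ (A ∆ A') = 0)
    {p : X → I} (hp : MA p) (hH : Hpart μ p < ⊤) :
    Tendsto (fun n => HpartC μ p (sAlg (w n))) atTop (𝓝 0) := by
  let ℱ : Filtration ℕ mX :=
    { seq := fun n => sAlg (w n)
      mono' := by
        intro i j hij s hs
        obtain ⟨t, -, rfl⟩ := hs
        refine ⟨w j '' (w i ⁻¹' t), trivial, ?_⟩
        ext x
        constructor
        · rintro ⟨y, hy, hxy⟩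
          have := hmono i j hij _ _ hxy
          simp only [Set.mem_preimage] at *
          rw [← this]; exact hy
        · intro hx; exact ⟨x, hx, rfl⟩
      le' := fun n => sAlg_le (hw n) }
  have hle : ∀ n, sAlg (w n) ≤ mX := fun n => sAlg_le (hw n)
  have hlim : ∀ B : Set X, MeasurableSet B →
      Tendsto (fun n => ∫⁻ x, condExpKernel μ (sAlg (w n)) x B *
        Lg (condExpKernel μ (sAlg (w n)) x B) ∂μ) atTop (𝓝 0) := by
    intro B hB
    have h1 := MeasureTheory.tendsto_ae_condExp (μ := μ) (ℱ := ℱ) (B.indicator fun _ => (1:ℝ))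
    have h2 : ∀ᵐ x ∂μ, (μ[B.indicator (fun _ => (1:ℝ)) | ⨆ n, ℱ n]) x
        = B.indicator (fun _ => (1:ℝ)) x := by
      obtain ⟨A, hA, hBA⟩ := hgen B hB
      have hae : B =ᵐ[μ] A := measure_symmDiff_eq_zero_iff.1 hBA
      have hae' : B.indicator (fun _ => (1:ℝ)) =ᵐ[μ] A.indicator (fun _ => (1:ℝ)) :=
        indicator_ae_eq_of_ae_eq_set hae
      have hsup : (⨆ n, ℱ n) ≤ mX := iSup_le fun n => hle n
      have hA' : MeasurableSet[⨆ n, ℱ n] A := hA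
      have h3 : μ[A.indicator (fun _ => (1:ℝ)) | ⨆ n, ℱ n] = A.indicator (fun _ => (1:ℝ)) :=
        condExp_of_stronglyMeasurable hsup (stronglyMeasurable_const.indicator hA')
          ((integrable_const _).indicator (hsup _ hA'))
      have h4 := condExp_congr_ae (m := ⨆ n, ℱ n) hae'
      rw [h3] at h4
      exact h4.trans hae'.symm
    have h3 : ∀ᵐ x ∂μ, ∀ n, (μ[B.indicator (fun _ => (1:ℝ)) | sAlg (w n)]) x
        = (condExpKernel μ (sAlg (w n)) x B).toReal :=
      ae_all_iff.2 fun n => kernel_ae μ (hle n) hB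
    rw [show (0 : ℝ≥0∞) = ∫⁻ x : X, 0 ∂μ by simp]
    refine tendsto_lintegral_of_dominated_convergence (fun _ => 1) ?_ ?_ (by simp) ?_
    · exact fun n => (meas_kernel μ (hle n) hB).fun_mul
        (Lg_measurable.fun_comp (meas_kernel μ (hle n) hB))
    · intro n
      refine Eventually.of_forall fun x => ?_
      have := key (t := condExpKernel μ (sAlg (w n)) x B) (u := 1) (v := 1) (w := 1) prob_le_one
        le_rfl le_rfl le_rfl (by simp) (by simp) (by simp)
      simp only [Lg_one, mul_zero, add_zero, mul_one, ENNReal.div_self one_ne_zero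
        ENNReal.one_ne_top, zero_add] at this
      exact le_self_add.trans this
    · filter_upwards [h1, h2, h3] with x h1 h2 h3
      rw [h2] at h1
      have h4 : Tendsto (fun n => ENNReal.ofReal (Real.negMulLog
          ((μ[B.indicator (fun _ => (1:ℝ)) | ℱ n]) x))) atTop
          (𝓝 (ENNReal.ofReal (Real.negMulLog (B.indicator (fun _ => (1:ℝ)) x)))) :=
        ENNReal.tendsto_ofReal ((Real.continuous_negMulLog.tendsto _).comp h1)
      have h5 : ENNReal.ofReal (Real.negMulLog (B.indicator (fun _ => (1:ℝ)) x)) = 0 := by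
        by_cases hx : x ∈ B <;> simp [hx]
      rw [h5] at h4
      refine h4.congr fun n => ?_
      rw [← negMulLog_eq _ prob_le_one, ← h3]
  have hexp : ∀ n, HpartC μ p (sAlg (w n)) = ∑' i, ∫⁻ x, condExpKernel μ (sAlg (w n)) x (p ⁻¹' {i})
      * Lg (condExpKernel μ (sAlg (w n)) x (p ⁻¹' {i})) ∂μ := by
    intro n
    rw [HpartC_eq μ (hle n) hp]
    simp only [Hpart_eq]
    rw [lintegral_tsum fun i => ((meas_kernel μ (hle n) (hp i)).fun_mul
      (Lg_measurable.fun_comp (meas_kernel μ (hle n) (hp i)))).aemeasurable]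
  simp only [hexp]
  let _ : MeasurableSpace I := ⊤
  have hcount : ∀ f : I → ℝ≥0∞, ∑' i, f i = ∫⁻ i, f i ∂Measure.count :=
    fun f => (lintegral_count f).symm
  simp only [hcount]
  rw [show (0 : ℝ≥0∞) = ∫⁻ i : I, 0 ∂Measure.count by simp]
  refine tendsto_lintegral_of_dominated_convergence
    (fun i => μ (p ⁻¹' {i}) * Lg (μ (p ⁻¹' {i}))) (fun n => measurable_from_top) ?_ ?_ ?_
  · exact fun n => Eventually.of_forall fun i => ent_bound μ (hle n) (hp i)
  · rw [← hcount, ← Hpart_eq]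
    exact hH.ne
  · exact Eventually.of_forall fun i => hlim _ (hp i)

end HD

set_option linter.unusedSectionVars false
section Dyn
open ProbabilityTheory Topology

variable {r : ℕ} {X : Type*} {m : MeasurableSpace X} [mX : MeasurableSpace X]

/-- The standing hypotheses. -/
structure Hyp {r : ℕ} {X : Type*} (m : MeasurableSpace X) [mX : MeasurableSpace X]
    (μ : Measure X) (T : FG r → X → X) : Prop where
  one : T 1 = id
  mul : ∀ g h : FG r, T (g * h) = T g ∘ T h
  mp : ∀ g : FG r, MeasurePreserving (T g) μ μ
  le : m ≤ mX
  inv : ∀ (g : FG r) (A : Set X), MeasurableSet[m] A → MeasurableSet[m] (T g ⁻¹' A)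

/-- Measurable partition of finite entropy. -/
def Good {K : Type*} (μ : Measure X) (p : X → K) : Prop := MA p ∧ Hpart μ p < ⊤

/-- Real valued conditional entropy. -/
def HH {K : Type*} (m : MeasurableSpace X) [mX : MeasurableSpace X] (μ : Measure X) (p : X → K) : ℝ :=
  (HpartC μ p m).toReal

variable [StandardBorelSpace X] {μ : Measure X} [IsProbabilityMeasure μ] {T : FG r → X → X}
  {I J K L : Type*} [Countable I] [Countable J] [Countable K] [Countable L]

lemma Hyp.app (hy : Hyp m μ T) (g h : FG r) (x : X) : T g (T h x) = T (g * h) x := by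
  rw [hy.mul]; rfl

lemma Hyp.app_one (hy : Hyp m μ T) (x : X) : T 1 x = x := by
  rw [hy.one]; rfl

lemma Good.co {p : X → I} {q : X → J} (hp : Good μ p) (h : Co p q) : Good μ q :=
  ⟨hp.1.co h, (Hpart_mono μ hp.1 h).trans_lt hp.2⟩

lemma Good.join {p : X → I} {q : X → J} (hp : Good μ p) (hq : Good μ q) : Good μ (pjoin p q) := by
  refine ⟨hp.1.pjoin hq.1, ?_⟩
  have := Hpart_submod (w := fun _ : X => ()) (d := pjoin p q) μ hp.1 hq.1
    (fun _ _ _ => rfl) (fun _ _ _ => rfl) (fun _ _ h => h)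
  exact (le_self_add.trans this).trans_lt (ENNReal.add_lt_top.2 ⟨hp.2, hq.2⟩)

lemma Good.unit : Good μ (fun _ : X => ()) := ⟨fun k => by simp, by rw [Hpart_unit]; simp⟩

lemma Good.pull (hy : Hyp m μ T) (g : FG r) {p : X → I} (hp : Good μ p) :
    Good μ (pull T g p) := by
  constructor
  · intro k
    exact (hy.mp g).measurable (hp.1 k)
  · rw [show Bowen.pull T g p = fun x => p (T g x) from rfl, Hpart_pull μ (hy.mp g) hp.1]
    exact hp.2

lemma Good.ne_top (hy : Hyp m μ T) {p : X → I} (hp : Good μ p) : HpartC μ p m ≠ ⊤ :=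
  ((HpartC_le μ hy.le hp.1).trans_lt hp.2).ne

lemma HH_nonneg (p : X → I) : 0 ≤ HH m μ p := ENNReal.toReal_nonneg

lemma HH_mono (hy : Hyp m μ T) {p : X → I} {q : X → J} (hp : Good μ p) (h : Co p q) :
    HH m μ q ≤ HH m μ p :=
  ENNReal.toReal_mono (hp.ne_top hy) (HpartC_mono μ hy.le hp.1 h)

lemma HH_submod (hy : Hyp m μ T) {p : X → I} {q : X → J} {w : X → K} {d : X → L}
    (hp : Good μ p) (hq : Good μ q) (hpw : Co p w) (hqw : Co q w) (hd : Co (pjoin p q) d) :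
    HH m μ d + HH m μ w ≤ HH m μ p + HH m μ q := by
  have hw := hp.co hpw
  have hd' := (hp.join hq).co hd
  have := HpartC_submod μ hy.le hp.1 hq.1 hpw hqw hd
  unfold HH
  rw [← ENNReal.toReal_add (hd'.ne_top hy) (hw.ne_top hy),
    ← ENNReal.toReal_add (hp.ne_top hy) (hq.ne_top hy)]
  exact ENNReal.toReal_mono (ENNReal.add_ne_top.2 ⟨hp.ne_top hy, hq.ne_top hy⟩) this

lemma HH_pull (hy : Hyp m μ T) (g : FG r) {p : X → I} (hp : Good μ p) :
    HH m μ (pull T g p) = HH m μ p := by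
  unfold HH
  congr 1
  refine HpartC_pull μ hy.le (hy.mp g) (S' := T g⁻¹) (hy.mp g⁻¹).measurable ?_ ?_
    (fun A hA => hy.inv g A hA) (fun A hA => hy.inv g⁻¹ A hA) hp.1
  · intro x; rw [hy.app, mul_inv_cancel, hy.app_one]
  · intro x; rw [hy.app, inv_mul_cancel, hy.app_one]

lemma Good.family (hy : Hyp m μ T) {p : X → I} (hp : Good μ p) {ι : Type*} [Finite ι]
    (g : ι → FG r) : Good μ (fun x (i : ι) => p (T (g i) x)) := by
  have key : ∀ n (g : Fin n → FG r), Good μ (fun x (i : Fin n) => p (T (g i) x)) := by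
    intro n
    induction n with
    | zero => exact fun g => Good.unit.co fun x y _ => Subsingleton.elim _ _
    | succ n ih =>
      intro g
      refine ((ih (fun i => g i.castSucc)).join (hp.pull hy (g (Fin.last n)))).co ?_
      intro x y hxy
      simp only [pjoin, Prod.mk.injEq, Bowen.pull] at hxy
      funext i
      refine Fin.lastCases ?_ (fun i => ?_) i
      · exact hxy.2
      · exact congrFun hxy.1 i
  obtain ⟨n, ⟨e⟩⟩ := Finite.exists_equiv_fin ι
  refine (key n (fun i => g (e.symm i))).co ?_
  intro x y hxy
  funext i
  have := congrFun hxy (e i)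
  simpa using this

/-- Iterates. -/
def itr {K : Type*} (T : FG r → X → X) (s : FG r) (p : X → K) (n : ℕ) : X → (Fin n → K) :=
  fun x i => p (T (s ^ (i : ℕ)) x)

lemma itr_good (hy : Hyp m μ T) {p : X → I} (hp : Good μ p) (s : FG r) (n : ℕ) :
    Good μ (itr T s p n) := hp.family hy fun i : Fin n => s ^ (i : ℕ)

lemma itr_iff {p : X → I} {s : FG r} {n : ℕ} {x y : X} :
    itr T s p n x = itr T s p n y ↔ ∀ i < n, p (T (s ^ i) x) = p (T (s ^ i) y) := by
  constructor
  · intro h i hi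
    exact congrFun h ⟨i, hi⟩
  · intro h
    funext i
    exact h i i.2

lemma itr_subadd (hy : Hyp m μ T) {p : X → I} (hp : Good μ p) (s : FG r) :
    Subadditive fun n => HH m μ (itr T s p n) := by
  intro a b
  have h := HH_submod (w := fun _ : X => ()) (d := itr T s p (a + b)) hy (itr_good hy hp s a)
    ((itr_good hy hp s b).pull hy (s ^ a))
    (fun _ _ _ => rfl) (fun _ _ _ => rfl) ?_
  · rw [HH_pull hy _ (itr_good hy hp s b)] at h
    have := HH_nonneg (m := m) (μ := μ) (fun _ : X => ())
    simp only
    linarith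
  · intro x y hxy
    simp only [pjoin, Prod.mk.injEq, pull, itr_iff] at *
    intro i hi
    by_cases hia : i < a
    · exact hxy.1 i hia
    · have := hxy.2 (i - a) (by omega)
      rw [hy.app, hy.app, ← pow_add] at this
      rwa [show i - a + a = i by omega] at this

lemma hrate_bdd (p : X → I) (s : FG r) : BddBelow (Set.range fun n : ℕ =>
    HH m μ (itr T s p n) / n) :=
  ⟨0, by rintro _ ⟨n, rfl⟩; exact div_nonneg (HH_nonneg _) (by positivity)⟩

lemma hrate_bdd' (p : X → I) (s : FG r) : BddBelow (Set.range fun n : ℕ =>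
    HH m μ (itr T s p (n + 1)) / ((n : ℝ) + 1)) :=
  ⟨0, by rintro _ ⟨n, rfl⟩; exact div_nonneg (HH_nonneg _) (by positivity)⟩

lemma hrate_eq (p : X → I) (s : FG r) :
    hrateC T μ m s p = ⨅ n : ℕ, HH m μ (itr T s p (n + 1)) / ((n : ℝ) + 1) := rfl

lemma hrate_tendsto (hy : Hyp m μ T) {p : X → I} (hp : Good μ p) (s : FG r) :
    Tendsto (fun n : ℕ => HH m μ (itr T s p (n + 1)) / ((n : ℝ) + 1)) atTop
      (𝓝 (hrateC T μ m s p)) := by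
  have h := (itr_subadd hy hp s).tendsto_lim (hrate_bdd p s)
  have e : (itr_subadd hy hp s).lim = hrateC T μ m s p := by
    rw [hrate_eq, Subadditive.lim, iInf]
    congr 1
    ext c
    constructor
    · rintro ⟨n, hn, rfl⟩
      obtain ⟨k, rfl⟩ : ∃ k, n = k + 1 := ⟨n - 1, by have : 1 ≤ n := hn; omega⟩
      exact ⟨k, by simp⟩
    · rintro ⟨n, rfl⟩
      exact ⟨n + 1, by simp, by simp⟩
  rw [e] at h
  have := h.comp (tendsto_add_atTop_nat 1)
  refine this.congr fun n => ?_
  simp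

lemma hrate_mono (hy : Hyp m μ T) {p : X → I} {q : X → J} (hp : Good μ p) (h : Co p q)
    (s : FG r) : hrateC T μ m s q ≤ hrateC T μ m s p := by
  rw [hrate_eq, hrate_eq]
  apply ciInf_mono (hrate_bdd' q s)
  intro n
  gcongr
  apply HH_mono hy (itr_good hy hp s _)
  intro x y hxy
  rw [itr_iff] at *
  exact fun i hi => h _ _ (hxy i hi)

lemma itr_cont (hy : Hyp m μ T) {p : X → I} {q : X → J} (hp : Good μ p) (h : Co p q)
    (s : FG r) (n : ℕ) :
    HH m μ (itr T s p n) ≤ HH m μ (itr T s q n) + n * (HH m μ p - HH m μ q) := by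
  have hq := hp.co h
  induction n with
  | zero =>
    simp only [Nat.cast_zero, zero_mul, add_zero]
    exact HH_mono hy (itr_good hy hq s 0) fun x y _ => Subsingleton.elim _ _
  | succ n ih =>
    have h1 := HH_submod (w := itr T s q n) (d := pjoin (itr T s p n) (pull T (s ^ n) q)) hy
      (itr_good hy hp s n) (itr_good hy hq s (n + 1))
      (fun x y hxy => by
        rw [itr_iff] at *
        exact fun i hi => h _ _ (hxy i hi))
      (fun x y hxy => by
        rw [itr_iff] at *
        exact fun i hi => hxy i (by omega))
      (fun x y hxy => by
        simp only [pjoin, Prod.mk.injEq, itr_iff, pull] at *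
        exact ⟨hxy.1, hxy.2 n (by omega)⟩)
    have h2 := HH_submod (w := pull T (s ^ n) q) (d := itr T s p (n + 1)) hy
      (hp.pull hy (s ^ n)) ((itr_good hy hp s n).join (hq.pull hy (s ^ n)))
      (fun x y hxy => h _ _ hxy)
      (fun x y hxy => by
        simp only [pjoin, Prod.mk.injEq] at *
        exact hxy.2)
      (fun x y hxy => by
        simp only [pjoin, Prod.mk.injEq, itr_iff, pull] at *
        intro i hi
        rcases Nat.lt_succ_iff_lt_or_eq.1 hi with h | h
        · exact hxy.2.1 i h
        · rw [h]; exact hxy.1)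
    rw [HH_pull hy _ hp, HH_pull hy _ hq] at h2
    push_cast
    linarith

lemma hrate_cont (hy : Hyp m μ T) {p : X → I} {q : X → J} (hp : Good μ p) (h : Co p q)
    (s : FG r) : hrateC T μ m s p ≤ hrateC T μ m s q + (HH m μ p - HH m μ q) := by
  have h1 := hrate_tendsto hy hp s
  have h2 := (hrate_tendsto hy (hp.co h) s).add_const (HH m μ p - HH m μ q)
  refine le_of_tendsto_of_tendsto' h1 h2 fun n => ?_
  have h3 := itr_cont hy hp h s (n + 1)
  have hn : (0 : ℝ) < (n : ℝ) + 1 := by positivity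
  rw [div_le_iff₀ hn, add_mul, div_mul_cancel₀ _ hn.ne']
  push_cast at h3
  linarith

lemma hrate_split (hy : Hyp m μ T) {p : X → I} {q : X → J} (hp : Good μ p) (hq : Good μ q)
    (s : FG r) (h : ∀ n, HH m μ (itr T s q n) ≤ HH m μ (itr T s p (n + 1))) :
    hrateC T μ m s q ≤ hrateC T μ m s p := by
  have h1 := hrate_tendsto hy hq s
  have h2 := (hrate_tendsto hy hp s).add
    (tendsto_one_div_add_atTop_nhds_zero_nat.const_mul (HH m μ (itr T s p 1)))
  rw [mul_zero, add_zero] at h2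
  refine le_of_tendsto_of_tendsto' h1 h2 fun n => ?_
  have h3 := h (n + 1)
  have h4 := itr_subadd hy hp s (n + 1) 1
  simp only at h4
  rw [← div_eq_mul_one_div, ← add_div]
  gcongr
  linarith

/-- Admissible functionals. -/
structure Adm (m : MeasurableSpace X) [mX : MeasurableSpace X] (μ : Measure X)
    (T : FG r → X → X) (Φ : ∀ {K : Type}, (X → K) → ℝ) : Prop where
  split : ∀ {K L M : Type} [Countable K] [Countable L] [Countable M] (α : X → K) (σ : X → L)
    (γ : X → M) (t : Fin r × Bool), Good μ α → Good μ σ → Co α γ → Co σ α →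
    Co (pjoin α (pull T (gen t) γ)) σ → Φ σ ≤ Φ α
  cont : ∀ {K L : Type} [Countable K] [Countable L] (α : X → K) (σ : X → L),
    Good μ σ → Co σ α → Φ σ ≤ Φ α + 2 * r * (HH m μ σ - HH m μ α) ∧
      Φ α ≤ Φ σ + 2 * r * (HH m μ σ - HH m μ α)

lemma pj_iff {p : X → I} {q : X → J} {x y : X} :
    pjoin p q x = pjoin p q y ↔ p x = p y ∧ q x = q y := by
  simp [pjoin]

lemma FF_step (hy : Hyp m μ T) {α : X → I} {σ : X → J} (hσ : Good μ σ) (h : Co σ α) (s : FG r) :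
    HH m μ (pjoin σ (pull T s σ)) ≤
      HH m μ (pjoin α (pull T s α)) + 2 * (HH m μ σ - HH m μ α) := by
  have hα := hσ.co h
  have h1 := HH_submod (w := α) (d := pjoin σ (pull T s α)) hy hσ (hα.join (hα.pull hy s))
    h (fun x y hxy => (pj_iff.1 hxy).1)
    (fun x y hxy => by
      simp only [pj_iff] at *
      exact ⟨hxy.1, hxy.2.2⟩)
  have h2 := HH_submod (w := pull T s α) (d := pjoin σ (pull T s σ)) hy (hσ.pull hy s)
    (hσ.join (hα.pull hy s)) (fun x y hxy => h _ _ hxy) (fun x y hxy => (pj_iff.1 hxy).2)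
    (fun x y hxy => by
      simp only [pj_iff] at *
      exact ⟨hxy.2.1, hxy.1⟩)
  rw [HH_pull hy _ hσ, HH_pull hy _ hα] at h2
  linarith

lemma FF_step_mono (hy : Hyp m μ T) {α : X → I} {σ : X → J} (hσ : Good μ σ) (h : Co σ α)
    (s : FG r) :
    HH m μ (pjoin α (pull T s α)) ≤ HH m μ (pjoin σ (pull T s σ)) := by
  apply HH_mono hy (hσ.join (hσ.pull hy s))
  intro x y hxy
  simp only [pj_iff] at *
  exact ⟨h _ _ hxy.1, h _ _ hxy.2⟩

lemma FF_step_split (hy : Hyp m μ T) {α : X → I} {σ : X → J} {γ : X → K} (hα : Good μ α)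
    (hσ : Good μ σ) (hγ : Co α γ) (h : Co σ α) (i : Fin r) (b : Bool)
    (hs : Co (pjoin α (pull T (gen (i, b)) γ)) σ) :
    HH m μ (pjoin σ (pull T (FreeGroup.of i) σ)) ≤
      HH m μ (pjoin α (pull T (FreeGroup.of i) α)) + (HH m μ σ - HH m μ α) := by
  set s : FG r := FreeGroup.of i with hsdef
  cases b with
  | true =>
    have e : gen (i, true) = s := rfl
    rw [e] at hs
    have h2 := HH_submod (w := pull T s α) (d := pjoin σ (pull T s σ)) hy (hσ.pull hy s)
      (hα.join (hα.pull hy s)) (fun x y hxy => h _ _ hxy) (fun x y hxy => (pj_iff.1 hxy).2)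
      (fun x y hxy => by
        simp only [pj_iff] at *
        exact ⟨hs _ _ (pj_iff.2 ⟨hxy.2.1, hγ _ _ hxy.2.2⟩), hxy.1⟩)
    rw [HH_pull hy _ hσ, HH_pull hy _ hα] at h2
    linarith
  | false =>
    have e : gen (i, false) = s⁻¹ := rfl
    rw [e] at hs
    have h2 := HH_submod (w := α) (d := pjoin σ (pull T s σ)) hy hσ
      (hα.join (hα.pull hy s)) h (fun x y hxy => (pj_iff.1 hxy).1)
      (fun x y hxy => by
        simp only [pj_iff] at *
        refine ⟨hxy.1, hs _ _ (pj_iff.2 ⟨hxy.2.2, ?_⟩)⟩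
        simp only [pull, hy.app, inv_mul_cancel, hy.app_one]
        exact hγ _ _ hxy.2.1)
    linarith

lemma FF_eq (p : X → I) : FFc T μ m p = (1 - 2 * (r : ℝ)) * HH m μ p
    + ∑ i : Fin r, HH m μ (pjoin p (pull T (FreeGroup.of i) p)) := rfl

lemma Fs_eq (p : X → I) : FstarC T μ m p = (1 - (r : ℝ)) * HH m μ p
    + ∑ i : Fin r, hrateC T μ m (FreeGroup.of i) p := rfl

lemma FF_adm (hr : 1 ≤ r) (hy : Hyp m μ T) : Adm m μ T (fun {K} (p : X → K) => FFc T μ m p) where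
  split := by
    rintro K L M _ _ _ α σ γ ⟨j, b⟩ hα hσ hγ h hs
    have hD : 0 ≤ HH m μ σ - HH m μ α := sub_nonneg.2 (HH_mono hy hσ h)
    set D := HH m μ σ - HH m μ α with hDdef
    have hsum : ∑ i : Fin r, HH m μ (pjoin σ (pull T (FreeGroup.of i) σ)) ≤
        ∑ i : Fin r, (HH m μ (pjoin α (pull T (FreeGroup.of i) α)) + 2 * D
          - if i = j then D else 0) := by
      apply Finset.sum_le_sum
      intro i _
      by_cases hij : i = j
      · subst hij
        have := FF_step_split hy hα hσ hγ h i b hs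
        simp only [if_true]
        linarith
      · have := FF_step hy hσ h (FreeGroup.of i)
        simp only [hij, if_false]
        linarith
    rw [Finset.sum_sub_distrib, Finset.sum_add_distrib] at hsum
    simp only [Finset.sum_const, Finset.card_univ, Fintype.card_fin, nsmul_eq_mul,
      Finset.sum_ite_eq', Finset.mem_univ, if_true] at hsum
    simp only [FF_eq]
    have : HH m μ σ = HH m μ α + D := by rw [hDdef]; ring
    rw [this]
    linarith
  cont := by
    intro K L _ _ α σ hσ h
    have hD : 0 ≤ HH m μ σ - HH m μ α := sub_nonneg.2 (HH_mono hy hσ h)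
    set D := HH m μ σ - HH m μ α with hDdef
    have e : HH m μ σ = HH m μ α + D := by rw [hDdef]; ring
    have h1 : ∑ i : Fin r, HH m μ (pjoin σ (pull T (FreeGroup.of i) σ)) ≤
        ∑ i : Fin r, (HH m μ (pjoin α (pull T (FreeGroup.of i) α)) + 2 * D) :=
      Finset.sum_le_sum fun i _ => FF_step hy hσ h (FreeGroup.of i)
    have h2 : ∑ i : Fin r, HH m μ (pjoin α (pull T (FreeGroup.of i) α)) ≤
        ∑ i : Fin r, HH m μ (pjoin σ (pull T (FreeGroup.of i) σ)) :=
      Finset.sum_le_sum fun i _ => FF_step_mono hy hσ h (FreeGroup.of i)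
    rw [Finset.sum_add_distrib] at h1
    simp only [Finset.sum_const, Finset.card_univ, Fintype.card_fin, nsmul_eq_mul] at h1
    simp only [FF_eq, e]
    have hr' : (1 : ℝ) ≤ r := by exact_mod_cast hr
    have := mul_nonneg (sub_nonneg.2 hr') hD
    constructor <;> nlinarith

lemma Fs_adm (hr : 1 ≤ r) (hy : Hyp m μ T) :
    Adm m μ T (fun {K} (p : X → K) => FstarC T μ m p) where
  split := by
    rintro K L M _ _ _ α σ γ ⟨j, b⟩ hα hσ hγ h hs
    have hD : 0 ≤ HH m μ σ - HH m μ α := sub_nonneg.2 (HH_mono hy hσ h)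
    set D := HH m μ σ - HH m μ α with hDdef
    have hj : hrateC T μ m (FreeGroup.of j) σ ≤ hrateC T μ m (FreeGroup.of j) α := by
      apply hrate_split hy hα hσ
      intro n
      set s : FG r := FreeGroup.of j with hsdef
      cases b with
      | true =>
        have e : gen (j, true) = s := rfl
        rw [e] at hs
        apply HH_mono hy (itr_good hy hα s (n + 1))
        intro x y hxy
        rw [itr_iff] at *
        intro i hi
        refine hs _ _ (pj_iff.2 ⟨hxy i (by omega), ?_⟩)
        simp only [pull, hy.app, ← pow_succ']
        exact hγ _ _ (hxy (i + 1) (by omega))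
      | false =>
        have e : gen (j, false) = s⁻¹ := rfl
        rw [e] at hs
        rw [← HH_pull hy s (itr_good hy hσ s n)]
        apply HH_mono hy (itr_good hy hα s (n + 1))
        intro x y hxy
        simp only [pull, itr_iff, hy.app, ← pow_succ] at *
        intro i hi
        refine hs _ _ (pj_iff.2 ⟨hxy (i + 1) (by omega), ?_⟩)
        simp only [pull, hy.app, pow_succ', inv_mul_cancel_left]
        exact hγ _ _ (hxy i (by omega))
    have hsum : ∑ i : Fin r, hrateC T μ m (FreeGroup.of i) σ ≤
        ∑ i : Fin r, (hrateC T μ m (FreeGroup.of i) α + D - if i = j then D else 0) := by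
      apply Finset.sum_le_sum
      intro i _
      by_cases hij : i = j
      · subst hij
        simp only [if_true]
        linarith
      · have := hrate_cont hy hσ h (FreeGroup.of i)
        simp only [hij, if_false]
        linarith
    rw [Finset.sum_sub_distrib, Finset.sum_add_distrib] at hsum
    simp only [Finset.sum_const, Finset.card_univ, Fintype.card_fin, nsmul_eq_mul,
      Finset.sum_ite_eq', Finset.mem_univ, if_true] at hsum
    simp only [Fs_eq]
    have : HH m μ σ = HH m μ α + D := by rw [hDdef]; ring
    rw [this]
    linarith
  cont := by
    intro K L _ _ α σ hσ h
    have hD : 0 ≤ HH m μ σ - HH m μ α := sub_nonneg.2 (HH_mono hy hσ h)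
    set D := HH m μ σ - HH m μ α with hDdef
    have e : HH m μ σ = HH m μ α + D := by rw [hDdef]; ring
    have h1 : ∑ i : Fin r, hrateC T μ m (FreeGroup.of i) σ ≤
        ∑ i : Fin r, (hrateC T μ m (FreeGroup.of i) α + D) :=
      Finset.sum_le_sum fun i _ => hrate_cont hy hσ h (FreeGroup.of i)
    have h2 : ∑ i : Fin r, hrateC T μ m (FreeGroup.of i) α ≤
        ∑ i : Fin r, hrateC T μ m (FreeGroup.of i) σ :=
      Finset.sum_le_sum fun i _ => hrate_mono hy hσ h (FreeGroup.of i)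
    rw [Finset.sum_add_distrib] at h1
    simp only [Finset.sum_const, Finset.card_univ, Fintype.card_fin, nsmul_eq_mul] at h1
    simp only [Fs_eq, e]
    have hr' : (1 : ℝ) ≤ r := by exact_mod_cast hr
    have := mul_nonneg (sub_nonneg.2 hr') hD
    constructor <;> nlinarith

end Dyn

set_option linter.unusedSectionVars false
section Fin6
open ProbabilityTheory Topology

lemma ball_finite (r n : ℕ) : (ball r n).Finite := by
  have h := List.finite_length_le (Fin r × Bool) n
  refine Set.Finite.of_finite_image (f := FreeGroup.toWord) (h.subset ?_)
    FreeGroup.toWord_injective.injOn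
  rintro _ ⟨g, hg, rfl⟩
  exact hg

instance ball_fin (r n : ℕ) : Finite (ball r n) := (ball_finite r n).to_subtype

lemma ball_mono {r i j : ℕ} (h : i ≤ j) : ball r i ⊆ ball r j := fun _ hg => le_trans hg h

lemma gen_eq {r : ℕ} (t : Fin r × Bool) : gen t = FreeGroup.mk [t] := by
  obtain ⟨i, b⟩ := t
  cases b
  · simp [gen, FreeGroup.of, FreeGroup.inv_mk, FreeGroup.invRev]
  · rfl

lemma ball_step {r n : ℕ} {h : FG r} (hh : h ∈ ball r (n + 1)) :
    h ∈ ball r n ∨ ∃ g ∈ ball r n, ∃ t : Fin r × Bool, h = g * gen t := by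
  by_cases h0 : h ∈ ball r n
  · exact Or.inl h0
  right
  rcases List.eq_nil_or_concat (FreeGroup.toWord h) with h1 | ⟨L, t, hL⟩
  · exfalso
    apply h0
    simp [ball, FreeGroup.norm, h1]
  · refine ⟨FreeGroup.mk L, ?_, t, ?_⟩
    · refine le_trans FreeGroup.norm_mk_le ?_
      have : (FreeGroup.toWord h).length ≤ n + 1 := hh
      rw [hL] at this
      simpa using this
    · rw [gen_eq, FreeGroup.mul_mk]
      conv_lhs => rw [← FreeGroup.mk_toWord (x := h), hL]
      simp

variable {r : ℕ} {X : Type*} {m : MeasurableSpace X} [mX : MeasurableSpace X]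
variable [StandardBorelSpace X] {μ : Measure X} [IsProbabilityMeasure μ] {T : FG r → X → X}
  {Φ : ∀ {K : Type}, (X → K) → ℝ}

lemma powS_iff {K : Type*} {p : X → K} {Q : Set (FG r)} {x y : X} :
    powS T p Q x = powS T p Q y ↔ ∀ g ∈ Q, p (T g x) = p (T g y) := by
  constructor
  · intro h g hg
    exact congrFun h ⟨g, hg⟩
  · intro h
    funext g
    exact h g.1 g.2

lemma pow_iff {K : Type*} {p : X → K} {n : ℕ} {x y : X} :
    pow T p n x = pow T p n y ↔ ∀ g ∈ ball r n, p (T g x) = p (T g y) := powS_iff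

lemma Good.powS (hy : Hyp m μ T) {K : Type*} [Countable K] {p : X → K} (hp : Good μ p)
    (Q : Set (FG r)) [Finite Q] : Good μ (powS T p Q) := hp.family hy (fun q : Q => (q : FG r))

lemma Good.pow (hy : Hyp m μ T) {K : Type*} [Countable K] {p : X → K} (hp : Good μ p)
    (n : ℕ) : Good μ (pow T p n) := hp.powS hy (ball r n)

lemma Adm.eq_le (ha : Adm m μ T Φ) (hy : Hyp m μ T) {K L : Type} [Countable K] [Countable L]
    {α : X → K} {σ : X → L} (hσ : Good μ σ) (h : Co σ α) (h' : Co α σ) : Φ σ ≤ Φ α := by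
  have h1 := HH_mono hy (hσ.co h) h'
  have h2 := HH_mono hy hσ h
  have h3 := (ha.cont α σ hσ h).1
  rw [le_antisymm h1 h2] at h3
  simpa using h3

lemma Adm.expand (ha : Adm m μ T Φ) (hy : Hyp m μ T) {K L : Type} [Countable K] [Countable L]
    {ρ : X → K} {α : X → L} (hρ : Good μ ρ) (hα : Good μ α) (n : ℕ) :
    Φ (pjoin ρ (pow T α (n + 1))) ≤ Φ (pjoin ρ (pow T α n)) := by
  classical
  have key : ∀ E : Finset (FG r), (↑E : Set (FG r)) ⊆ ball r (n + 1) →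
      Φ (pjoin ρ (powS T α (ball r n ∪ ↑E))) ≤ Φ (pjoin ρ (pow T α n)) := by
    intro E
    induction E using Finset.induction_on with
    | empty =>
      intro _
      apply ha.eq_le hy (hρ.join (hα.powS hy _))
      · intro x y hxy
        simp only [pj_iff, pow_iff, powS_iff] at *
        exact ⟨hxy.1, fun g hg => hxy.2 g (Or.inl hg)⟩
      · intro x y hxy
        simp only [pj_iff, pow_iff, powS_iff] at *
        refine ⟨hxy.1, fun g hg => ?_⟩
        rcases hg with hg | hg
        · exact hxy.2 g hg
        · simp at hg
    | insert h E _ ih =>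
      intro hE
      have hE' : (↑E : Set (FG r)) ⊆ ball r (n + 1) := fun g hg => hE (by simp [Finset.mem_coe.1 hg])
      refine le_trans ?_ (ih hE')
      have hh : h ∈ ball r (n + 1) := hE (by simp)
      have hco : Co (pjoin ρ (powS T α (ball r n ∪ ↑(insert h E))))
          (pjoin ρ (powS T α (ball r n ∪ ↑E))) := by
        intro x y hxy
        simp only [pj_iff, powS_iff] at *
        refine ⟨hxy.1, fun g hg => hxy.2 g ?_⟩
        rcases hg with hg | hg
        · exact Or.inl hg
        · exact Or.inr (by simp [Finset.mem_coe.1 hg])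
      rcases ball_step hh with h0 | ⟨g, hg, t, rfl⟩
      · apply ha.eq_le hy (hρ.join (hα.powS hy _)) hco
        intro x y hxy
        simp only [pj_iff, powS_iff] at *
        refine ⟨hxy.1, fun g hg => hxy.2 g ?_⟩
        rcases hg with hg | hg
        · exact Or.inl hg
        · rcases Finset.mem_insert.1 (Finset.mem_coe.1 hg) with rfl | hg
          · exact Or.inl h0
          · exact Or.inr hg
      · refine ha.split _ _ (pull T g α) t (hρ.join (hα.powS hy _)) (hρ.join (hα.powS hy _))
          ?_ hco ?_
        · intro x y hxy
          simp only [pj_iff, powS_iff] at *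
          exact hxy.2 g (Or.inl hg)
        · intro x y hxy
          simp only [pj_iff, powS_iff, pull, hy.app] at *
          refine ⟨hxy.1.1, fun k hk => ?_⟩
          rcases hk with hk | hk
          · exact hxy.1.2 k (Or.inl hk)
          · rcases Finset.mem_insert.1 (Finset.mem_coe.1 hk) with rfl | hk
            · exact hxy.2
            · exact hxy.1.2 k (Or.inr hk)
  have h1 := key (ball_finite r (n + 1)).toFinset (by simp)
  refine le_trans ?_ h1
  apply ha.eq_le hy (hρ.join (hα.pow hy _))
  · intro x y hxy
    simp only [pj_iff, pow_iff, powS_iff] at *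
    refine ⟨hxy.1, fun g hg => hxy.2 g ?_⟩
    rcases hg with hg | hg
    · exact ball_mono (Nat.le_succ n) hg
    · simpa using hg
  · intro x y hxy
    simp only [pj_iff, pow_iff, powS_iff] at *
    exact ⟨hxy.1, fun g hg => hxy.2 g (Or.inr (by simpa using hg))⟩

lemma Adm.join_anti (ha : Adm m μ T Φ) (hy : Hyp m μ T) {K L : Type} [Countable K] [Countable L]
    {ρ : X → K} {α : X → L} (hρ : Good μ ρ) (hα : Good μ α) {i j : ℕ} (hij : i ≤ j) :
    Φ (pjoin ρ (pow T α j)) ≤ Φ (pjoin ρ (pow T α i)) :=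
  antitone_nat_of_succ_le (f := fun n => Φ (pjoin ρ (pow T α n)))
    (fun n => ha.expand hy hρ hα n) hij

lemma Adm.pow_anti (ha : Adm m μ T Φ) (hy : Hyp m μ T) {L : Type} [Countable L]
    {α : X → L} (hα : Good μ α) {i j : ℕ} (hij : i ≤ j) :
    Φ (pow T α j) ≤ Φ (pow T α i) := by
  have h := ha.join_anti hy (Good.unit (μ := μ)) hα hij
  have h1 := ha.eq_le hy (hα.pow hy j) (α := pjoin (fun _ : X => ()) (pow T α j))
    (fun x y hxy => pj_iff.2 ⟨rfl, hxy⟩) (fun x y hxy => (pj_iff.1 hxy).2)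
  have h2 := ha.eq_le hy (Good.unit.join (hα.pow hy i)) (α := pow T α i)
    (fun x y hxy => (pj_iff.1 hxy).2) (fun x y hxy => pj_iff.2 ⟨rfl, hxy⟩)
  exact h1.trans (h.trans h2)

lemma gen_limit (hy : Hyp m μ T) {K L : Type} [Countable K] [Countable L]
    {α : X → K} {p : X → L} (hα : Good μ α) (hp : Good μ p) (hg : Generating T μ α)
    {δ : ℝ} (hδ : 0 < δ) :
    ∃ N, ∀ n ≥ N, HH m μ (pjoin (pow T α n) p) ≤ HH m μ (pow T α n) + δ := by
  have ht := gen_tendsto (p := p) μ (fun n => pow T α n) (fun n => (hα.pow hy n).1)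
    (by
      intro i j hij x y hxy
      simp only [pow_iff] at *
      exact fun g hg => hxy g (ball_mono hij hg))
    (by
      intro A hA
      obtain ⟨A', h1, h2⟩ := hg A hA
      refine ⟨A', ?_, h2⟩
      have hle : sAlgG T α ≤ ⨆ n, sAlg (pow T α n) := by
        refine iSup_le fun g => le_trans ?_ (le_iSup (fun n => sAlg (pow T α n)) (FreeGroup.norm g))
        rintro _ ⟨s, -, rfl⟩
        exact ⟨(fun f => f ⟨g, le_refl (FreeGroup.norm g)⟩) ⁻¹' s, trivial, rfl⟩
      exact hle _ h1) hp.1 hp.2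
  have hev := ht.eventually (gt_mem_nhds (ENNReal.ofReal_pos.2 hδ))
  obtain ⟨N, hN⟩ := eventually_atTop.1 hev
  refine ⟨N, fun n hn => ?_⟩
  have hw := hα.pow hy n
  have hlt := hN n hn
  have h1 := HpartC_mix μ hy.le hp.1 hw.1
  have h2 := Hpart_chain μ hw.1 hp.1
  have h3 : HpartC μ (pjoin (pow T α n) p) m ≤ HpartC μ (pow T α n) m + ENNReal.ofReal δ := by
    have : HpartC μ (pjoin (pow T α n) p) m + Hpart μ (pow T α n) ≤
        (HpartC μ (pow T α n) m + ENNReal.ofReal δ) + Hpart μ (pow T α n) := by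
      refine h1.trans ?_
      rw [add_assoc]
      gcongr
      refine h2.trans ?_
      rw [add_comm]
      gcongr
    exact (ENNReal.add_le_add_iff_right hw.2.ne).1 this
  have hfin := hw.ne_top hy
  have h4 := ENNReal.toReal_mono (by simp [hfin]) h3
  rw [ENNReal.toReal_add hfin (by simp), ENNReal.toReal_ofReal hδ.le] at h4
  exact h4

lemma Adm.main (ha : Adm m μ T Φ) (hy : Hyp m μ T) {K L : Type} [Countable K] [Countable L]
    {α : X → K} {β : X → L} (hα : Good μ α) (hβ : Good μ β) (hga : Generating T μ α)
    (hgb : Generating T μ β) :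
    (⨅ n : ℕ, ((Φ (pow T α (n + 1)) : ℝ) : EReal)) ≤ ⨅ n : ℕ, ((Φ (pow T β (n + 1)) : ℝ) : EReal) := by
  refine le_iInf fun j => ?_
  have key : ∀ δ : ℝ, 0 < δ → ∃ n, Φ (pow T α (n + 1)) ≤ Φ (pow T β (j + 1)) + 4 * r * δ := by
    intro δ hδ
    obtain ⟨N, hN⟩ := gen_limit hy hβ (hα.pow hy 0) hgb hδ
    set k := max N (j + 1) with hk
    have h1 := hN k (le_max_left _ _)
    have hbk := hβ.pow hy k
    obtain ⟨M, hM⟩ := gen_limit hy hα hbk hga hδ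
    have h2 := hM (M + 1) (by omega)
    have hr0 : (0 : ℝ) ≤ 2 * r := by positivity
    have c1 := (ha.cont (pow T β k) (pjoin (pow T β k) (pow T α 0)) (hbk.join (hα.pow hy 0))
      (fun x y hxy => (pj_iff.1 hxy).1)).1
    have c2 := ha.pow_anti hy hβ (le_max_right N (j + 1))
    have c3 := ha.join_anti hy hbk hα (Nat.zero_le (M + 1))
    have hsw : HH m μ (pjoin (pow T β k) (pow T α (M + 1))) ≤
        HH m μ (pjoin (pow T α (M + 1)) (pow T β k)) :=
      HH_mono hy ((hα.pow hy _).join hbk) (fun x y hxy => pj_iff.2 (pj_iff.1 hxy).symm)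
    have c4 := (ha.cont (pow T α (M + 1)) (pjoin (pow T β k) (pow T α (M + 1)))
      (hbk.join (hα.pow hy _)) (fun x y hxy => (pj_iff.1 hxy).2)).2
    refine ⟨M, ?_⟩
    have e1 : 2 * (r : ℝ) * (HH m μ (pjoin (pow T β k) (pow T α 0)) - HH m μ (pow T β k)) ≤
        2 * r * δ := mul_le_mul_of_nonneg_left (by linarith) hr0
    have e2 : 2 * (r : ℝ) * (HH m μ (pjoin (pow T β k) (pow T α (M + 1)))
        - HH m μ (pow T α (M + 1))) ≤ 2 * r * δ := mul_le_mul_of_nonneg_left (by linarith) hr0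
    rw [← hk] at c2
    linarith
  by_contra hcon
  rw [not_le] at hcon
  obtain ⟨c, hc1, hc2⟩ := EReal.lt_iff_exists_real_btwn.1 hcon
  have hc1' : Φ (pow T β (j + 1)) < c := EReal.coe_lt_coe_iff.1 hc1
  have hpos : (0 : ℝ) < 4 * r + 1 := by positivity
  obtain ⟨n, hn⟩ := key ((c - Φ (pow T β (j + 1))) / (4 * r + 1)) (div_pos (by linarith) hpos)
  have h5 : 4 * (r : ℝ) * ((c - Φ (pow T β (j + 1))) / (4 * r + 1)) ≤ c - Φ (pow T β (j + 1)) := by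
    rw [mul_div_assoc', div_le_iff₀ hpos]
    nlinarith
  have h6 : Φ (pow T α (n + 1)) ≤ c := by linarith
  have h7 := iInf_le (fun n : ℕ => ((Φ (pow T α (n + 1)) : ℝ) : EReal)) n
  exact absurd (hc2.trans_le (h7.trans (EReal.coe_le_coe_iff.2 h6))) (lt_irrefl _)

lemma main_thm (hr : 1 ≤ r) (hy : Hyp m μ T) {α β : X → ℕ} (hα : Good μ α) (hβ : Good μ β)
    (hga : Generating T μ α) (hgb : Generating T μ β) :
    littleFc T μ m α = littleFc T μ m β ∧ fstarC T μ m α = fstarC T μ m β :=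
  ⟨le_antisymm ((FF_adm hr hy).main hy hα hβ hga hgb) ((FF_adm hr hy).main hy hβ hα hgb hga),
   le_antisymm ((Fs_adm hr hy).main hy hα hβ hga hgb) ((Fs_adm hr hy).main hy hβ hα hgb hga)⟩

lemma main_explicit (hr : 1 ≤ r) (hT1 : T 1 = id)
    (hTmul : ∀ g h : FG r, T (g * h) = T g ∘ T h)
    (hTmp : ∀ g : FG r, MeasurePreserving (T g) μ μ)
    (α β : X → ℕ) (hαm : Measurable α) (hβm : Measurable β)
    (hHα : Hpart μ α < ⊤) (hHβ : Hpart μ β < ⊤)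
    (hαgen : Generating T μ α) (hβgen : Generating T μ β) (hm : m ≤ mX)
    (hminv : ∀ (g : FG r) (A : Set X), MeasurableSet[m] A → MeasurableSet[m] (T g ⁻¹' A)) :
    littleFc T μ m α = littleFc T μ m β ∧ fstarC T μ m α = fstarC T μ m β :=
  main_thm hr ⟨hT1, hTmul, hTmp, hm, hminv⟩
    ⟨fun k => hαm (MeasurableSet.singleton k), hHα⟩
    ⟨fun k => hβm (MeasurableSet.singleton k), hHβ⟩ hαgen hβgen

end Fin6

/-- for two finite-entropy generating partitions `α, β` and a
`T(G)`-invariant sub-σ-algebra `m`, `f(α|m) = f(β|m)` and `f_*(α|m) = f_*(β|m)`. -/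
theorem stmt_7 {r : ℕ} (hr : 1 ≤ r) {X : Type*} [mX : MeasurableSpace X]
    [StandardBorelSpace X] (μ : Measure X) [IsProbabilityMeasure μ]
    (T : FG r → X → X) (hT1 : T 1 = id)
    (hTmul : ∀ g h : FG r, T (g * h) = T g ∘ T h)
    (hTmp : ∀ g : FG r, MeasurePreserving (T g) μ μ)
    (α β : X → ℕ) (hαm : Measurable α) (hβm : Measurable β)
    (hHα : Hpart μ α < ⊤) (hHβ : Hpart μ β < ⊤)
    (hαgen : Generating T μ α) (hβgen : Generating T μ β)
    (m : MeasurableSpace X) (hm : m ≤ mX)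
    (hminv : ∀ (g : FG r) (A : Set X), MeasurableSet[m] A → MeasurableSet[m] (T g ⁻¹' A)) :
    littleFc (mX := mX) T μ m α = littleFc (mX := mX) T μ m β ∧
      fstarC (mX := mX) T μ m α = fstarC (mX := mX) T μ m β := by
  exact @main_explicit r X m mX _ μ _ T hr hT1 hTmul hTmp α β hαm hβm hHα hHβ hαgen hβgen hm hminv

end

end Bowen
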